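/- arXiv:0802.3278 — 2 statements merged into one kernel-verified Lean document; each statement's English description precedes it below -/
import Mathlib

section
/- Let E ⊆ ℝ^{n−1} and e ∈ E be such that E_e := {e'−e : e' ∈ E} is not contained in a union of n−1 proper linear subspaces of ℝ^{n−1}. Suppose v ∈ V satisfies u(e')v ∈ V⁰ + V⁻ for all e' ∈ E. Then π₀(u(e)v) ≠ 0 and π₀(u(e)v) is fixed by the full centralizer Z(A) of A in G = SL(n,ℝ). -/
noncomputable section

open Matrix

/-- `X(ξ)`: first row `(0, ξ)`, zeros elsewhere. -/
def Xmat (m : ℕ) (ξ : Fin m → ℝ) : Matrix (Fin (m + 1)) (Fin (m + 1)) ℝ :=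
  Matrix.of (Fin.cons (Fin.cons 0 ξ) 0)

/-- `u(ξ)`: unipotent matrix with `1`s on the diagonal and first row `(1, ξ)`. -/
def uMat (m : ℕ) (ξ : Fin m → ℝ) : Matrix (Fin (m + 1)) (Fin (m + 1)) ℝ :=
  1 + Xmat m ξ

lemma Xmat_apply_succ (m : ℕ) (ξ : Fin m → ℝ) (i : Fin m) (j : Fin (m + 1)) :
    Xmat m ξ i.succ j = 0 := by
  simp [Xmat]

lemma uMat_det (m : ℕ) (ξ : Fin m → ℝ) : (uMat m ξ).det = 1 := by
  have h : (uMat m ξ).BlockTriangular id := by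
    intro i j hij
    have hi : i ≠ 0 := by
      rintro rfl; exact Fin.not_lt_zero j hij
    obtain ⟨i', rfl⟩ := Fin.eq_succ_of_ne_zero hi
    have hne : (i'.succ : Fin (m+1)) ≠ j := by
      intro h; subst h; exact lt_irrefl _ hij
    simp [uMat, Matrix.one_apply, hne, Xmat_apply_succ]
  rw [Matrix.det_of_upperTriangular h]
  have : ∀ i, uMat m ξ i i = 1 := by
    intro i
    rcases Fin.eq_zero_or_eq_succ i with rfl | ⟨i', rfl⟩
    · simp [uMat, Xmat, Matrix.one_apply]
    · simp [uMat, Matrix.one_apply, Xmat_apply_succ]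
  simp [this]

/-- `u(ξ)` as an element of `SL(n, ℝ)`. -/
def uSL (m : ℕ) (ξ : Fin m → ℝ) : Matrix.SpecialLinearGroup (Fin (m + 1)) ℝ :=
  ⟨uMat m ξ, uMat_det m ξ⟩

/-- The diagonal matrix `a_t = diag(e^{(n-1)t}, e^{-t}, …, e^{-t})`. -/
def aMat (m : ℕ) (t : ℝ) : Matrix (Fin (m + 1)) (Fin (m + 1)) ℝ :=
  Matrix.diagonal (Fin.cons (Real.exp (m * t)) fun _ => Real.exp (-t))

lemma aMat_det (m : ℕ) (t : ℝ) : (aMat m t).det = 1 := by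
  rw [aMat, Matrix.det_diagonal, Fin.prod_cons]
  simp only [Finset.prod_const, Finset.card_univ, Fintype.card_fin]
  rw [← Real.exp_nat_mul, ← Real.exp_add]
  ring_nf
  exact Real.exp_zero

/-- `a_t` as an element of `SL(n, ℝ)`. -/
def aSL (m : ℕ) (t : ℝ) : Matrix.SpecialLinearGroup (Fin (m + 1)) ℝ :=
  ⟨aMat m t, aMat_det m t⟩

/-- Topology on `SL(n, ℝ)`, induced from the space of matrices. -/
instance SLtop (m : ℕ) : TopologicalSpace (Matrix.SpecialLinearGroup (Fin (m + 1)) ℝ) :=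
  TopologicalSpace.induced
    (fun g => (g : Matrix (Fin (m + 1)) (Fin (m + 1)) ℝ)) inferInstance

variable {V : Type*} [AddCommGroup V] [Module ℝ V]

/-- The weight space `V^μ` of the one-parameter diagonal group `{a_t}` acting through
the representation `ρ`: the set of `v` with `ρ(a_t) v = e^{μ t} v` for all `t`. -/
def wtSpace (m : ℕ)
    (ρ : Matrix.SpecialLinearGroup (Fin (m + 1)) ℝ →* Module.End ℝ V) (μ : ℝ) :
    Submodule ℝ V :=
  ⨅ t : ℝ, Module.End.eigenspace (ρ (aSL m t)) (Real.exp (μ * t))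

/-- The block matrix with corner entry `a`, remaining first row `r`, remaining first column `c`
and lower right block `D`. -/
def blk {m : ℕ} (a : ℝ) (r c : Fin m → ℝ) (D : Matrix (Fin m) (Fin m) ℝ) :
    Matrix (Fin (m + 1)) (Fin (m + 1)) ℝ :=
  Matrix.of (Fin.cons (Fin.cons a r) fun i => Fin.cons (c i) (D i))

section Blocks

variable {m : ℕ}

lemma eq_blk (M : Matrix (Fin (m + 1)) (Fin (m + 1)) ℝ) :
    M = blk (M 0 0) (fun j => M 0 j.succ) (fun i => M i.succ 0)
      (Matrix.of fun i j => M i.succ j.succ) := by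
  ext i j
  refine Fin.cases ?_ (fun i => ?_) i <;> refine Fin.cases ?_ (fun j => ?_) j <;> simp [blk]

lemma blk_mul (a a' : ℝ) (r c r' c' : Fin m → ℝ) (D D' : Matrix (Fin m) (Fin m) ℝ) :
    blk a r c D * blk a' r' c' D' =
      blk (a * a' + r ⬝ᵥ c') (a • r' + r ᵥ* D') (a' • c + D *ᵥ c')
        (Matrix.vecMulVec c r' + D * D') := by
  ext i j
  refine Fin.cases ?_ (fun i => ?_) i <;> refine Fin.cases ?_ (fun j => ?_) j <;>
    simp [blk, Matrix.mul_apply, Fin.sum_univ_succ, dotProduct, vecMul, mulVec, vecMulVec, mul_comm]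

lemma blk_inj {a a' : ℝ} {r c r' c' : Fin m → ℝ} {D D' : Matrix (Fin m) (Fin m) ℝ} :
    blk a r c D = blk a' r' c' D' ↔ a = a' ∧ r = r' ∧ c = c' ∧ D = D' := by
  refine ⟨fun h => ⟨?_, ?_, ?_, ?_⟩, fun ⟨h₁, h₂, h₃, h₄⟩ => by rw [h₁, h₂, h₃, h₄]⟩
  · simpa [blk] using congr_fun₂ h 0 0
  · ext j; simpa [blk] using congr_fun₂ h 0 j.succ
  · ext i; simpa [blk] using congr_fun₂ h i.succ 0
  · ext i j; simpa [blk] using congr_fun₂ h i.succ j.succ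

lemma one_eq_blk : (1 : Matrix (Fin (m + 1)) (Fin (m + 1)) ℝ) = blk 1 0 0 1 := by
  rw [eq_blk 1, blk_inj]
  refine ⟨by simp, ?_, ?_, ?_⟩ <;> ext j <;> simp [Matrix.one_apply, (Fin.succ_ne_zero j).symm]

lemma diagonal_eq_blk (f : Fin (m + 1) → ℝ) :
    Matrix.diagonal f = blk (f 0) 0 0 (Matrix.diagonal fun i => f i.succ) := by
  rw [eq_blk (Matrix.diagonal f), blk_inj]
  refine ⟨by simp, ?_, ?_, ?_⟩ <;> ext j <;> simp [Matrix.diagonal_apply, (Fin.succ_ne_zero j).symm]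

lemma det_blk_lower (a : ℝ) (c : Fin m → ℝ) (D : Matrix (Fin m) (Fin m) ℝ) :
    (blk a 0 c D).det = a * D.det := by
  rw [Matrix.det_succ_row_zero, Fin.sum_univ_succ, Finset.sum_eq_zero]
  · simp only [blk, Fin.val_zero, pow_zero, one_mul, Matrix.of_apply, Fin.cons_zero,
      Fin.succAbove_zero, add_zero]
    rfl
  · intro j _
    simp [blk]

lemma uMat_eq_blk (ξ : Fin m → ℝ) : uMat m ξ = blk 1 ξ 0 1 := by
  rw [uMat, one_eq_blk]
  ext i j
  refine Fin.cases ?_ (fun i => ?_) i <;> refine Fin.cases ?_ (fun j => ?_) j <;>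
    simp [blk, Xmat]

lemma aMat_eq_blk (t : ℝ) :
    aMat m t = blk (Real.exp (m * t)) 0 0 (Real.exp (-t) • (1 : Matrix (Fin m) (Fin m) ℝ)) := by
  rw [aMat, diagonal_eq_blk, Matrix.smul_one_eq_diagonal]
  simp

end Blocks

/-- The lower unipotent matrix with first column `(1, y)`. -/
def lowSL {m : ℕ} (y : Fin m → ℝ) : Matrix.SpecialLinearGroup (Fin (m + 1)) ℝ :=
  ⟨blk 1 0 y 1, by simp [det_blk_lower]⟩

/-- The embedding of invertible `m × m` matrices as the centralizer of `{a_t}`. -/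
def leviSL {m : ℕ} (D : Matrix (Fin m) (Fin m) ℝ) (h : D.det ≠ 0) :
    Matrix.SpecialLinearGroup (Fin (m + 1)) ℝ :=
  ⟨blk D.det⁻¹ 0 0 D, by rw [det_blk_lower, inv_mul_cancel₀ h]⟩

/-- The positive diagonal torus, parametrized so that the `i`-th coordinate direction is the
conjugate of `{a_t}` with its large entry at position `i`. -/
def torSL {m : ℕ} (d : Fin (m + 1) → ℝ) : Matrix.SpecialLinearGroup (Fin (m + 1)) ℝ :=
  ⟨Matrix.diagonal fun j => Real.exp ((m + 1) * d j - ∑ i, d i), by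
    rw [Matrix.det_diagonal, ← Real.exp_sum, Finset.sum_sub_distrib, ← Finset.mul_sum]
    simp⟩

/-- The Weyl element exchanging the coordinates `0` and `i + 1`. -/
def weylSL {m : ℕ} (i : Fin m) : Matrix.SpecialLinearGroup (Fin (m + 1)) ℝ :=
  uSL m (Pi.single i 1) * lowSL (-Pi.single i 1) * uSL m (Pi.single i 1)

section GroupIdentities

variable {m : ℕ}

lemma coe_uSL (ξ : Fin m → ℝ) :
    (uSL m ξ : Matrix (Fin (m + 1)) (Fin (m + 1)) ℝ) = blk 1 ξ 0 1 := uMat_eq_blk ξ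

lemma coe_aSL (t : ℝ) : (aSL m t : Matrix (Fin (m + 1)) (Fin (m + 1)) ℝ) =
    blk (Real.exp (m * t)) 0 0 (Real.exp (-t) • (1 : Matrix (Fin m) (Fin m) ℝ)) := aMat_eq_blk t

lemma coe_lowSL (y : Fin m → ℝ) :
    (lowSL y : Matrix (Fin (m + 1)) (Fin (m + 1)) ℝ) = blk 1 0 y 1 := rfl

lemma coe_leviSL (D : Matrix (Fin m) (Fin m) ℝ) (h : D.det ≠ 0) :
    (leviSL D h : Matrix (Fin (m + 1)) (Fin (m + 1)) ℝ) = blk D.det⁻¹ 0 0 D := rfl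

lemma coe_torSL_diagonal (d : Fin (m + 1) → ℝ) :
    (torSL d : Matrix (Fin (m + 1)) (Fin (m + 1)) ℝ) =
      Matrix.diagonal fun j => Real.exp ((m + 1) * d j - ∑ i, d i) := rfl

lemma coe_torSL (d : Fin (m + 1) → ℝ) : (torSL d : Matrix (Fin (m + 1)) (Fin (m + 1)) ℝ) =
    blk (Real.exp ((m + 1) * d 0 - ∑ i, d i)) 0 0
      (Matrix.diagonal fun j => Real.exp ((m + 1) * d j.succ - ∑ i, d i)) := by
  rw [coe_torSL_diagonal, diagonal_eq_blk]

lemma uSL_add (ξ η : Fin m → ℝ) : uSL m (ξ + η) = uSL m ξ * uSL m η := by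
  apply Subtype.ext
  simp [coe_uSL, blk_mul, add_comm]

lemma uSL_zero : uSL m 0 = 1 := by
  apply Subtype.ext
  simp [coe_uSL, one_eq_blk]

lemma lowSL_add (y z : Fin m → ℝ) : lowSL (y + z) = lowSL y * lowSL z := by
  apply Subtype.ext
  simp [coe_lowSL, blk_mul]

lemma lowSL_zero : lowSL (0 : Fin m → ℝ) = 1 := by
  apply Subtype.ext
  simp [coe_lowSL, one_eq_blk]

lemma aSL_add (s t : ℝ) : aSL m (s + t) = aSL m s * aSL m t := by
  apply Subtype.ext
  simp [coe_aSL, blk_mul, mul_add, Real.exp_add, smul_smul]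

lemma leviSL_mul (A B : Matrix (Fin m) (Fin m) ℝ) (hA : A.det ≠ 0) (hB : B.det ≠ 0)
    (hAB : (A * B).det ≠ 0) : leviSL (A * B) hAB = leviSL A hA * leviSL B hB := by
  apply Subtype.ext
  simp [coe_leviSL, blk_mul, mul_comm]

lemma torSL_add (d d' : Fin (m + 1) → ℝ) : torSL (d + d') = torSL d * torSL d' := by
  apply Subtype.ext
  simp only [coe_torSL_diagonal, Matrix.SpecialLinearGroup.coe_mul, Matrix.diagonal_mul_diagonal,
    ← Real.exp_add, Pi.add_apply, Finset.sum_add_distrib]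
  congr 1
  ext j
  congr 1
  ring_nf

lemma torSL_const (t : ℝ) : torSL (fun _ : Fin (m + 1) => t) = 1 := by
  apply Subtype.ext
  simp [torSL]

lemma aSL_mul_lowSL (t : ℝ) (y : Fin m → ℝ) :
    aSL m t * lowSL y = lowSL (Real.exp (-((m + 1) * t)) • y) * aSL m t := by
  apply Subtype.ext
  have h : Real.exp (-t) = Real.exp (m * t) * Real.exp (-((m + 1) * t)) := by
    rw [← Real.exp_add]; ring_nf
  simp [coe_aSL, coe_lowSL, blk_mul, smul_smul, h, Matrix.smul_mulVec]

lemma aSL_mul_uSL (t : ℝ) (ξ : Fin m → ℝ) :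
    aSL m t * uSL m ξ = uSL m (Real.exp ((m + 1) * t) • ξ) * aSL m t := by
  apply Subtype.ext
  have h : Real.exp (m * t) = Real.exp (-t) * Real.exp ((m + 1) * t) := by
    rw [← Real.exp_add]; ring_nf
  simp [coe_aSL, coe_uSL, blk_mul, smul_smul, h, Matrix.vecMul_smul]

lemma leviSL_mul_aSL (D : Matrix (Fin m) (Fin m) ℝ) (h : D.det ≠ 0) (t : ℝ) :
    leviSL D h * aSL m t = aSL m t * leviSL D h := by
  apply Subtype.ext
  simp [coe_aSL, coe_leviSL, blk_mul, mul_comm]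

lemma leviSL_mul_uSL (D : Matrix (Fin m) (Fin m) ℝ) (h : D.det ≠ 0) (ξ η : Fin m → ℝ)
    (hη : D.det⁻¹ • ξ = η ᵥ* D) : leviSL D h * uSL m ξ = uSL m η * leviSL D h := by
  apply Subtype.ext
  simp [coe_uSL, coe_leviSL, blk_mul, hη]

lemma torSL_single_zero (t : ℝ) : torSL (Pi.single 0 t) = aSL m t := by
  apply Subtype.ext
  rw [coe_torSL, coe_aSL, Matrix.smul_one_eq_diagonal, blk_inj]
  simp [add_mul]

lemma diagonal_torSL_single (i : Fin m) (t : ℝ) :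
    (Matrix.diagonal fun j : Fin m => Real.exp ((m + 1) *
      (Pi.single i.succ t : Fin (m + 1) → ℝ) j.succ -
        ∑ k, (Pi.single i.succ t : Fin (m + 1) → ℝ) k))
      = Matrix.diagonal fun j => if j = i then Real.exp (m * t) else Real.exp (-t) := by
  congr 1
  ext j
  split_ifs with h
  · subst h; simp; ring
  · simp [h]

lemma coe_torSL_single_succ (i : Fin m) (t : ℝ) :
    (torSL (Pi.single i.succ t) : Matrix (Fin (m + 1)) (Fin (m + 1)) ℝ) =
      blk (Real.exp (-t)) 0 0
        (Matrix.diagonal fun j => if j = i then Real.exp (m * t) else Real.exp (-t)) := by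
  rw [coe_torSL, diagonal_torSL_single, blk_inj]
  simp

lemma coe_weylSL (i : Fin m) : (weylSL i : Matrix (Fin (m + 1)) (Fin (m + 1)) ℝ) =
    blk 0 (Pi.single i 1) (-Pi.single i 1) (1 - Matrix.single i i 1) := by
  simp [weylSL, coe_uSL, coe_lowSL, blk_mul, sub_eq_neg_add,
    Matrix.single_eq_single_vecMulVec_single]

/-- With `ξ ⬝ y = 1` supported on the `i`-th axis and `ξ ⬝ z = -1`, this product conjugates
the `i`-th one-parameter torus to `{a_t}`. -/
lemma aSL_mul_conj (i : Fin m) (t l : ℝ) (hl : l ≠ 0) (z : Fin m → ℝ) (hz : l * z i = -1) :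
    aSL m t * (lowSL (-Pi.single i l⁻¹) * uSL m (Pi.single i l) * lowSL z) =
      (lowSL (-Pi.single i l⁻¹) * uSL m (Pi.single i l) * lowSL z) *
        torSL (Pi.single i.succ t) := by
  apply Subtype.ext
  simp only [Matrix.SpecialLinearGroup.coe_mul, coe_torSL_single_succ, coe_aSL, coe_lowSL, coe_uSL,
    blk_mul, blk_inj]
  refine ⟨by simp [hz], ?_, ?_, ?_⟩
  · ext j
    by_cases h : j = i <;> simp [h, mul_comm]
  · ext j
    simp [hz, Matrix.smul_mulVec]
  · ext j k
    by_cases hk : k = i <;> by_cases hj : j = i <;>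
      simp [hk, hj, Matrix.vecMulVec_apply, Matrix.mul_diagonal, hl, mul_comm, Matrix.one_apply]

end GroupIdentities

section Polynomiality

/-- The generalized binomial coefficient is polynomial in its upper argument. -/
lemma exists_polynomial_choose (j : ℕ) :
    ∃ q : Polynomial ℝ, ∀ x : ℝ, q.eval x = Ring.choose x j := by
  refine ⟨Polynomial.C ((j.factorial : ℝ)⁻¹) *
    (descPochhammer ℤ j).map (Int.castRingHom ℝ), fun x => ?_⟩
  have h := Ring.descPochhammer_eq_factorial_smul_choose x j
  rw [← Polynomial.aeval_eq_smeval, Polynomial.aeval_def, ← Polynomial.eval_map] at h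
  rw [Polynomial.eval_mul, Polynomial.eval_C]
  have hj : (j.factorial : ℝ) ≠ 0 := by positivity
  rw [inv_mul_eq_iff_eq_mul₀ hj, ← nsmul_eq_mul, ← h]
  rfl

/-- The binomial expansion for integral powers of a unipotent element. -/
lemma zpow_eq_sum_choose {G A : Type*} [Group G] [Ring A] [Algebra ℝ A] (ρ : G →* A) (h : G)
    (d : ℕ) (hd : (ρ h - 1) ^ d = 0) (k : ℤ) :
    ρ (h ^ k) = ∑ j ∈ Finset.range (d + 1), Ring.choose (k : ℝ) j • (ρ h - 1) ^ j := by
  set N := ρ h - 1 with hN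
  let P : ℝ → A := fun x => ∑ j ∈ Finset.range (d + 1), Ring.choose x j • N ^ j
  have step : ∀ x : ℝ, P (x + 1) = ρ h * P x := by
    intro x
    have e₁ : N * P x = ∑ j ∈ Finset.range d, Ring.choose x j • N ^ (j + 1) := by
      simp only [P, Finset.sum_range_succ _ d, hd, smul_zero, add_zero, Finset.mul_sum,
        mul_smul_comm, pow_succ']
    have e₂ : ρ h = 1 + N := by rw [hN]; abel
    rw [e₂, add_mul, one_mul, e₁]
    simp only [P]
    rw [Finset.sum_range_succ', Finset.sum_range_succ']
    simp only [Ring.choose_succ_succ, add_smul, Finset.sum_add_distrib, Ring.choose_zero_right]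
    abel
  have key : ∀ k : ℤ, ρ (h ^ k) = P k := by
    intro k
    induction k with
    | zero =>
      simp only [P, zpow_zero, map_one, Finset.sum_range_succ']
      simp [Ring.choose_zero_succ]
    | succ n ih =>
      rw [add_comm, _root_.zpow_one_add, map_mul, ih, ← step]
      push_cast
      rw [add_comm]
    | pred n ih =>
      have e₁ : ρ (h ^ (-(n : ℤ))) = ρ h * ρ (h ^ (-(n : ℤ) - 1)) := by
        rw [← map_mul, ← _root_.zpow_one_add, add_sub_cancel]
      have e₂ := step ((-(n : ℤ) - 1 : ℤ) : ℝ)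
      rw [show ((-(n : ℤ) - 1 : ℤ) : ℝ) + 1 = ((-(n : ℤ) : ℤ) : ℝ) by push_cast; ring, ← ih,
        e₁] at e₂
      have e₃ := congrArg (ρ h⁻¹ * ·) e₂
      simpa [← mul_assoc, ← map_mul] using e₃
  exact key k

end Polynomiality

section Unipotent

variable {m : ℕ} {V : Type*} [NormedAddCommGroup V] [NormedSpace ℝ V]
  {ρ : Matrix.SpecialLinearGroup (Fin (m + 1)) ℝ →* Module.End ℝ V}

open Filter Topology

lemma tendsto_rho_apply [FiniteDimensional ℝ V] (hcont : ∀ v : V, Continuous fun g => ρ g v)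
    {ι : Type*} {l : Filter ι} {g : ι → Matrix.SpecialLinearGroup (Fin (m + 1)) ℝ} {x : ι → V} {g₀ x₀}
    (hg : Tendsto g l (𝓝 g₀)) (hx : Tendsto x l (𝓝 x₀)) :
    Tendsto (fun i => ρ (g i) (x i)) l (𝓝 (ρ g₀ x₀)) := by
  have hF : Continuous fun g => LinearMap.toContinuousLinearMap (ρ g) :=
    continuous_clm_apply.2 hcont
  have hFg : Tendsto (fun i => LinearMap.toContinuousLinearMap (ρ (g i))) l
      (𝓝 (LinearMap.toContinuousLinearMap (ρ g₀))) := (hF.tendsto g₀).comp hg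
  exact (isBoundedBilinearMap_apply.continuous.tendsto (_, x₀)).comp (hFg.prodMk_nhds hx)

/-- An element that can be contracted to the identity by conjugation acts unipotently. -/
lemma rho_sub_one_pow_finrank [FiniteDimensional ℝ V]
    (hcont : ∀ v : V, Continuous fun g => ρ g v) {ι : Type*}
    {l : Filter ι} [l.NeBot] {h : Matrix.SpecialLinearGroup (Fin (m + 1)) ℝ}
    {g k : ι → Matrix.SpecialLinearGroup (Fin (m + 1)) ℝ} (hgk : ∀ i, g i * h = k i * g i)
    (hk : Tendsto k l (𝓝 1)) : (ρ h - 1) ^ Module.finrank ℝ V = 0 := by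
  have hF : Continuous fun g => LinearMap.toContinuousLinearMap (ρ g) :=
    continuous_clm_apply.2 hcont
  have eval_charpoly : ∀ (f : Module.End ℝ V) (r : ℝ),
      f.charpoly.eval r = LinearMap.det (r • (1 : Module.End ℝ V) - f) := by
    intro f r
    rw [LinearMap.charpoly_def, Matrix.eval_charpoly,
      ← LinearMap.det_toMatrix (Module.Free.chooseBasis ℝ V)]
    congr 1
    simp [Matrix.smul_one_eq_diagonal, LinearMap.toMatrix_one]
  have conj : ∀ i (r : ℝ), LinearMap.det (r • (1 : Module.End ℝ V) - ρ (k i)) =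
      LinearMap.det (r • (1 : Module.End ℝ V) - ρ h) := by
    intro i r
    have hdet : LinearMap.det (ρ (g i)) ≠ 0 := by
      intro h0
      have h1 : LinearMap.det (ρ (g i * (g i)⁻¹)) = 1 := by simp
      rw [map_mul, map_mul, h0, zero_mul] at h1
      exact zero_ne_one h1
    apply mul_right_cancel₀ hdet
    rw [← map_mul, mul_comm, ← map_mul, sub_mul, mul_sub, ← map_mul, ← map_mul, hgk]
    simp
  have hchar : (ρ h).charpoly = (1 : Module.End ℝ V).charpoly := by
    apply Polynomial.funext
    intro r
    rw [eval_charpoly, eval_charpoly]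
    have hc : Continuous fun g => LinearMap.det (r • (1 : Module.End ℝ V) - ρ g) := by
      have := (ContinuousLinearMap.continuous_det (𝕜 := ℝ) (E := V)).comp
        ((continuous_const (y := r • ContinuousLinearMap.id ℝ V)).sub hF)
      exact this
    have ht := (hc.tendsto 1).comp hk
    simp only [Function.comp_def, conj, map_one] at ht
    exact tendsto_nhds_unique tendsto_const_nhds ht
  have hone : (1 : Module.End ℝ V).charpoly =
      (Polynomial.X - 1) ^ Module.finrank ℝ V := LinearMap.charpoly_one
  have := LinearMap.aeval_self_charpoly (ρ h)
  rw [hchar, hone] at this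
  simpa using this

/-- Integral powers of a unipotent element act polynomially in the exponent. -/
lemma exists_polynomial_zpow {d : ℕ} {h : Matrix.SpecialLinearGroup (Fin (m + 1)) ℝ}
    (hd : (ρ h - 1) ^ d = 0) :
    ∃ q : ℕ → Polynomial ℝ, ∀ c : ℤ,
      ρ (h ^ c) = ∑ j ∈ Finset.range (d + 1), (q j).eval (c : ℝ) • (ρ h - 1) ^ j := by
  choose q hq using exists_polynomial_choose
  exact ⟨q, fun c => by simp only [hq]; exact zpow_eq_sum_choose ρ h d hd c⟩

/-- Two families of matrix coefficients, polynomial in the exponent of unipotent elements, that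
agree at all positive exponents agree at the exponent `-1`. -/
lemma coeff_eq_of_unipotent {d : ℕ} {g h : Matrix.SpecialLinearGroup (Fin (m + 1)) ℝ}
    (hg : (ρ g - 1) ^ d = 0) (hh : (ρ h - 1) ^ d = 0) (φ : V →ₗ[ℝ] ℝ) (x : V)
    (H : ∀ c : ℕ, 1 ≤ c → φ (ρ (g ^ (c : ℤ) * h * g ^ (c : ℤ)) x) = φ (ρ (g * h ^ (c : ℤ) * g) x)) :
    φ (ρ (g⁻¹ * h * g⁻¹) x) = φ (ρ (g * h⁻¹ * g) x) := by
  obtain ⟨p, hp⟩ := exists_polynomial_zpow hg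
  obtain ⟨q, hq⟩ := exists_polynomial_zpow hh
  let P : Polynomial ℝ := ∑ i ∈ Finset.range (d + 1), ∑ j ∈ Finset.range (d + 1),
    Polynomial.C (φ (((ρ g - 1) ^ i * ρ h * (ρ g - 1) ^ j) x)) * (p i * p j)
  let Q : Polynomial ℝ := ∑ j ∈ Finset.range (d + 1),
    Polynomial.C (φ ((ρ g * (ρ h - 1) ^ j * ρ g) x)) * q j
  have hP : ∀ c : ℤ, φ (ρ (g ^ c * h * g ^ c) x) = P.eval (c : ℝ) := by
    intro c
    rw [map_mul, map_mul, hp]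
    simp only [P, Polynomial.eval_finsetSum, Polynomial.eval_mul, Polynomial.eval_C,
      Finset.sum_mul, Finset.mul_sum, LinearMap.sum_apply, map_sum, smul_mul_assoc, mul_smul_comm,
      LinearMap.smul_apply, map_smul, smul_eq_mul]
    rw [Finset.sum_comm]
    refine Finset.sum_congr rfl fun i _ => Finset.sum_congr rfl fun j _ => ?_
    ring
  have hQ : ∀ c : ℤ, φ (ρ (g * h ^ c * g) x) = Q.eval (c : ℝ) := by
    intro c
    rw [map_mul, map_mul, hq]
    simp only [Q, Polynomial.eval_finsetSum, Polynomial.eval_mul, Polynomial.eval_C,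
      Finset.sum_mul, Finset.mul_sum, LinearMap.sum_apply, map_sum, smul_mul_assoc, mul_smul_comm,
      LinearMap.smul_apply, map_smul, smul_eq_mul]
    exact Finset.sum_congr rfl fun j _ => mul_comm _ _
  have hPQ : P = Q := by
    apply Polynomial.eq_of_infinite_eval_eq
    refine Set.Infinite.mono ?_ (Set.infinite_range_of_injective
      (f := fun c : ℕ => ((c + 1 : ℕ) : ℝ)) fun a b hab => by simpa using hab)
    rintro _ ⟨c, rfl⟩
    have := H (c + 1) (by omega)
    rw [hP, hQ] at this
    simpa using this
  have h1 := hP (-1)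
  have h2 := hQ (-1)
  rw [hPQ, ← h2] at h1
  simpa using h1

end Unipotent

section Weights

open Filter Topology

variable {m : ℕ} {V : Type*} [NormedAddCommGroup V] [NormedSpace ℝ V]
  {ρ : Matrix.SpecialLinearGroup (Fin (m + 1)) ℝ →* Module.End ℝ V}

/-- A bounded sum of exponentials has no growing terms. -/
lemma eq_zero_of_bounded_sum_exp (s : Finset ℝ) {κ : ℝ → ℝ} (hκ : Function.Injective κ)
    (f : ℝ → V) (C : ℝ) (hb : ∀ k : ℕ, ‖∑ μ ∈ s, Real.exp (κ μ * k) • f μ‖ ≤ C) :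
    ∀ μ ∈ s, 0 < κ μ → f μ = 0 := by
  classical
  intro μ hμ hpos
  by_contra hne
  obtain ⟨ν, hν, hmax⟩ := (s.filter fun x => f x ≠ 0).exists_max_image κ
    ⟨μ, Finset.mem_filter.2 ⟨hμ, hne⟩⟩
  rw [Finset.mem_filter] at hν
  have hνpos : 0 < κ ν := hpos.trans_le (hmax μ (Finset.mem_filter.2 ⟨hμ, hne⟩))
  have decay : ∀ a : ℝ, a < 0 → Tendsto (fun k : ℕ => Real.exp (a * k)) atTop (𝓝 0) := fun a ha =>
    Real.tendsto_exp_atBot.comp (tendsto_natCast_atTop_atTop.const_mul_atTop_of_neg ha)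
  have h0 : Tendsto (fun k : ℕ => Real.exp (-κ ν * k) • ∑ x ∈ s, Real.exp (κ x * k) • f x)
      atTop (𝓝 0) := by
    refine squeeze_zero_norm (a := fun k : ℕ => Real.exp (-κ ν * k) * C) (fun k => ?_) ?_
    · rw [norm_smul, Real.norm_of_nonneg (Real.exp_pos _).le]
      exact mul_le_mul_of_nonneg_left (hb k) (Real.exp_pos _).le
    · simpa using (decay (-κ ν) (by linarith)).mul_const C
  have h1 : Tendsto (fun k : ℕ => Real.exp (-κ ν * k) • ∑ x ∈ s, Real.exp (κ x * k) • f x)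
      atTop (𝓝 (∑ x ∈ s, if x = ν then f ν else 0)) := by
    simp only [Finset.smul_sum, smul_smul, ← Real.exp_add, ← add_mul]
    refine tendsto_finsetSum _ fun x hx => ?_
    by_cases hfx : f x = 0
    · have : (if x = ν then f ν else 0) = 0 := by
        split_ifs with h
        · rw [← h, hfx]
        · rfl
      simp [hfx, this]
    · by_cases hxν : x = ν
      · simp [hxν]
      · have hle := hmax x (Finset.mem_filter.2 ⟨hx, hfx⟩)
        have hlt : κ x < κ ν := lt_of_le_of_ne hle fun h => hxν (hκ h)
        simpa [hxν] using (decay (-κ ν + κ x) (by linarith)).smul_const (f x)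
  have h2 := tendsto_nhds_unique h0 h1
  rw [Finset.sum_ite_eq' s ν, if_pos hν.1] at h2
  exact hν.2 h2.symm

lemma mem_wtSpace {μ : ℝ} {x : V} :
    x ∈ wtSpace m ρ μ ↔ ∀ t, ρ (aSL m t) x = Real.exp (μ * t) • x := by
  simp [wtSpace, Submodule.mem_iInf]

lemma mem_wtSpace_zero {x : V} : x ∈ wtSpace m ρ 0 ↔ ∀ t, ρ (aSL m t) x = x := by
  simp [mem_wtSpace]

lemma rho_mem_wtSpace {μ : ℝ} {x : V} (hx : x ∈ wtSpace m ρ μ)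
    {g : Matrix.SpecialLinearGroup (Fin (m + 1)) ℝ} (hg : ∀ t, g * aSL m t = aSL m t * g) :
    ρ g x ∈ wtSpace m ρ μ := by
  rw [mem_wtSpace] at hx ⊢
  intro t
  rw [← Module.End.mul_apply, ← map_mul, ← hg, map_mul, Module.End.mul_apply, hx, map_smul]

lemma mem_wtSpace_zero_of_bounded (hss : (⨆ μ : ℝ, wtSpace m ρ μ) = ⊤) {x : V} {C : ℝ}
    (hpos : ∀ k : ℕ, ‖ρ (aSL m k) x‖ ≤ C) (hneg : ∀ k : ℕ, ‖ρ (aSL m (-k)) x‖ ≤ C) :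
    x ∈ wtSpace m ρ 0 := by
  have hx : x ∈ ⨆ μ : ℝ, wtSpace m ρ μ := hss ▸ Submodule.mem_top
  obtain ⟨f, hf, rfl⟩ := (Submodule.mem_iSup_iff_exists_finsupp _ _).1 hx
  have hsum : ∀ t, ρ (aSL m t) (f.sum fun _ y => y) =
      ∑ μ ∈ f.support, Real.exp (μ * t) • f μ := by
    intro t
    rw [Finsupp.sum, map_sum]
    exact Finset.sum_congr rfl fun μ _ => mem_wtSpace.1 (hf μ) t
  have h₁ := eq_zero_of_bounded_sum_exp f.support Function.injective_id f C fun k => by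
    simpa [hsum] using hpos k
  have h₂ := eq_zero_of_bounded_sum_exp f.support neg_injective f C fun k => by
    simpa [hsum] using hneg k
  refine Submodule.sum_mem _ fun μ hμ => ?_
  rcases lt_trichotomy μ 0 with h | h | h
  · rw [h₂ μ hμ (by linarith)]; exact Submodule.zero_mem _
  · exact h ▸ hf μ
  · rw [h₁ μ hμ h]; exact Submodule.zero_mem _

section Projection

variable {π₀ : V →ₗ[ℝ] V}

lemma pi0_mem_wtSpace_zero (hss : (⨆ μ : ℝ, wtSpace m ρ μ) = ⊤)
    (hπ₀ : ∀ w ∈ wtSpace m ρ 0, π₀ w = w)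
    (hπ : ∀ μ : ℝ, μ ≠ 0 → ∀ w ∈ wtSpace m ρ μ, π₀ w = 0) (x : V) :
    π₀ x ∈ wtSpace m ρ 0 := by
  have hx : x ∈ ⨆ μ : ℝ, wtSpace m ρ μ := hss ▸ Submodule.mem_top
  refine Submodule.iSup_induction _ (motive := fun x => π₀ x ∈ wtSpace m ρ 0) hx
    (fun μ y hy => ?_) (by simp) fun y z hy hz => ?_
  · by_cases hμ : μ = 0
    · subst hμ; rwa [hπ₀ y hy]
    · rw [hπ μ hμ y hy]; exact Submodule.zero_mem _
  · rw [map_add]; exact Submodule.add_mem _ hy hz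

lemma pi0_rho (hss : (⨆ μ : ℝ, wtSpace m ρ μ) = ⊤)
    (hπ₀ : ∀ w ∈ wtSpace m ρ 0, π₀ w = w)
    (hπ : ∀ μ : ℝ, μ ≠ 0 → ∀ w ∈ wtSpace m ρ μ, π₀ w = 0)
    {g : Matrix.SpecialLinearGroup (Fin (m + 1)) ℝ} (hg : ∀ t, g * aSL m t = aSL m t * g) (x : V) :
    π₀ (ρ g x) = ρ g (π₀ x) := by
  have hx : x ∈ ⨆ μ : ℝ, wtSpace m ρ μ := hss ▸ Submodule.mem_top
  refine Submodule.iSup_induction _ (motive := fun x => π₀ (ρ g x) = ρ g (π₀ x)) hx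
    (fun μ y hy => ?_) (by simp) fun y z hy hz => by simp only [map_add, hy, hz]
  have hgy := rho_mem_wtSpace hy hg
  by_cases hμ : μ = 0
  · subst hμ; rw [hπ₀ y hy, hπ₀ _ hgy]
  · rw [hπ μ hμ y hy, hπ μ hμ _ hgy, map_zero]

/-- On `V⁰ + V⁻` the flow `a_t` converges to the projection `π₀`. -/
lemma tendsto_aSL_of_mem (hπ₀ : ∀ w ∈ wtSpace m ρ 0, π₀ w = w)
    (hπ : ∀ μ : ℝ, μ ≠ 0 → ∀ w ∈ wtSpace m ρ μ, π₀ w = 0) {x : V}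
    (hx : x ∈ wtSpace m ρ 0 ⊔ ⨆ μ ∈ Set.Iio (0 : ℝ), wtSpace m ρ μ) :
    Tendsto (fun t => ρ (aSL m t) x) atTop (𝓝 (π₀ x)) := by
  let S : Submodule ℝ V :=
    { carrier := {y | Tendsto (fun t => ρ (aSL m t) y) atTop (𝓝 (π₀ y))}
      add_mem' := fun {y z} hy hz => by
        simp only [Set.mem_ofPred_eq, map_add] at hy hz ⊢
        exact hy.add hz
      zero_mem' := by simp
      smul_mem' := fun c y hy => by
        simp only [Set.mem_ofPred_eq, map_smul] at hy ⊢
        exact hy.const_smul c }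
  refine (sup_le ?_ (iSup₂_le fun μ hμ => ?_) : _ ≤ S) hx
  · intro y hy
    change Tendsto _ _ _
    simp [hπ₀ y hy, mem_wtSpace_zero.1 hy]
  · intro y hy
    change Tendsto _ _ _
    simp only [mem_wtSpace.1 hy, hπ μ (ne_of_lt hμ) y hy]
    have : Tendsto (fun t : ℝ => Real.exp (μ * t)) atTop (𝓝 0) :=
      Real.tendsto_exp_atBot.comp (tendsto_id.const_mul_atTop_of_neg hμ)
    simpa using this.smul_const y

end Projection

lemma tendsto_lowSL {ι : Type*} {l : Filter ι} {c : ι → ℝ} (hc : Tendsto c l (𝓝 0))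
    (y : Fin m → ℝ) : Tendsto (fun i => lowSL (c i • y)) l (𝓝 1) := by
  rw [(Topology.IsInducing.mk rfl : Topology.IsInducing
    fun g : Matrix.SpecialLinearGroup (Fin (m + 1)) ℝ =>
      (g : Matrix (Fin (m + 1)) (Fin (m + 1)) ℝ)).tendsto_nhds_iff]
  have hcont : Continuous fun s : ℝ => blk 1 0 (s • y) (1 : Matrix (Fin m) (Fin m) ℝ) := by
    refine continuous_matrix fun i j => ?_
    refine Fin.cases ?_ (fun i => ?_) i <;> refine Fin.cases ?_ (fun j => ?_) j <;>
      simp [blk] <;> fun_prop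
  have := (hcont.tendsto 0).comp hc
  simpa [Function.comp_def, one_eq_blk, coe_lowSL] using this

lemma tendsto_uSL {ι : Type*} {l : Filter ι} {c : ι → ℝ} (hc : Tendsto c l (𝓝 0))
    (y : Fin m → ℝ) : Tendsto (fun i => uSL m (c i • y)) l (𝓝 1) := by
  rw [(Topology.IsInducing.mk rfl : Topology.IsInducing
    fun g : Matrix.SpecialLinearGroup (Fin (m + 1)) ℝ =>
      (g : Matrix (Fin (m + 1)) (Fin (m + 1)) ℝ)).tendsto_nhds_iff]
  have hcont : Continuous fun s : ℝ => blk 1 (s • y) 0 (1 : Matrix (Fin m) (Fin m) ℝ) := by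
    refine continuous_matrix fun i j => ?_
    refine Fin.cases ?_ (fun i => ?_) i <;> refine Fin.cases ?_ (fun j => ?_) j <;>
      simp [blk] <;> fun_prop
  have := (hcont.tendsto 0).comp hc
  simpa [Function.comp_def, one_eq_blk, coe_uSL] using this

lemma tendsto_exp_neg_succ_mul (m : ℕ) :
    Tendsto (fun t : ℝ => Real.exp (-((m + 1) * t))) atTop (𝓝 0) :=
  Real.tendsto_exp_neg_atTop_nhds_zero.comp
    (tendsto_id.const_mul_atTop (by positivity : (0 : ℝ) < m + 1))

/-- Lower unipotent elements do not change the limit under the flow `a_t`. -/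
lemma tendsto_aSL_lowSL [FiniteDimensional ℝ V] (hcont : ∀ v : V, Continuous fun g => ρ g v)
    {x x₀ : V} (hx : Tendsto (fun t => ρ (aSL m t) x) atTop (𝓝 x₀)) (y : Fin m → ℝ) :
    Tendsto (fun t => ρ (aSL m t) (ρ (lowSL y) x)) atTop (𝓝 x₀) := by
  have := tendsto_rho_apply hcont (tendsto_lowSL (tendsto_exp_neg_succ_mul m) y) hx
  simpa only [← Module.End.mul_apply, ← map_mul, ← aSL_mul_lowSL, map_one,
    Module.End.one_apply] using this

lemma one_sub_single (i : Fin m) : 1 - Matrix.single i i (1 : ℝ) =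
    Matrix.diagonal fun j => if j = i then 0 else 1 := by
  rw [← Matrix.diagonal_single, ← Matrix.diagonal_one, Matrix.diagonal_sub]
  congr 1
  ext j
  by_cases h : j = i
  · subst h; simp
  · simp [h]

lemma torSL_single_succ_mul_weylSL (i : Fin m) (t : ℝ) :
    torSL (Pi.single i.succ t) * weylSL i = weylSL i * aSL m t := by
  apply Subtype.ext
  simp only [Matrix.SpecialLinearGroup.coe_mul, coe_torSL_single_succ, coe_aSL, coe_weylSL,
    blk_mul, blk_inj]
  refine ⟨by simp, by simp [Matrix.vecMul_smul], ?_, ?_⟩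
  · ext j
    by_cases h : j = i
    · subst h; simp [Matrix.mulVec_diagonal]
    · simp [h, Matrix.mulVec_diagonal]
  · rw [one_sub_single, Matrix.diagonal_mul_diagonal, Matrix.mul_smul, mul_one]
    ext j k
    by_cases hj : j = i <;> simp [hj, Matrix.diagonal_apply]

lemma aSL_mul_weylSL (i : Fin m) (t : ℝ) :
    aSL m t * weylSL i = weylSL i * torSL (Pi.single i.succ t) := by
  apply Subtype.ext
  simp only [Matrix.SpecialLinearGroup.coe_mul, coe_torSL_single_succ, coe_aSL, coe_weylSL,
    blk_mul, blk_inj]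
  refine ⟨by simp, ?_, by simp [Matrix.smul_mulVec], ?_⟩
  · ext j
    by_cases h : j = i
    · subst h; simp
    · simp [h]
  · rw [one_sub_single, Matrix.diagonal_mul_diagonal, Matrix.smul_mul, one_mul]
    ext j k
    by_cases hj : j = i <;> simp [hj, Matrix.diagonal_apply]

lemma exists_conj_torSL_single (i : Fin (m + 1)) :
    ∃ g : Matrix.SpecialLinearGroup (Fin (m + 1)) ℝ,
      ∀ t, torSL (Pi.single i t) * g = g * aSL m t := by
  refine Fin.cases ⟨1, fun t => ?_⟩ (fun i => ⟨weylSL i, torSL_single_succ_mul_weylSL i⟩) i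
  rw [torSL_single_zero, mul_one, one_mul]

end Weights

section TorusFixed

open Filter Topology

variable {m : ℕ} {V : Type*} [NormedAddCommGroup V] [NormedSpace ℝ V]

/-- The vectors with bounded orbit under each `exp (k • single i 1)`, `k ∈ ℕ`. -/
def torBounded (ρ : Matrix.SpecialLinearGroup (Fin (m + 1)) ℝ →* Module.End ℝ V) :
    Submodule ℝ V where
  carrier := {x | ∀ i, ∃ C, ∀ k : ℕ, ‖ρ (torSL (Pi.single i (k : ℝ))) x‖ ≤ C}
  add_mem' := fun {x y} hx hy i => by
    obtain ⟨C, hC⟩ := hx i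
    obtain ⟨D, hD⟩ := hy i
    exact ⟨C + D, fun k => by rw [map_add]; exact norm_add_le_of_le (hC k) (hD k)⟩
  zero_mem' := fun i => ⟨0, by simp⟩
  smul_mem' := fun c x hx i => by
    obtain ⟨C, hC⟩ := hx i
    refine ⟨‖c‖ * C, fun k => ?_⟩
    rw [map_smul, norm_smul]
    exact mul_le_mul_of_nonneg_left (hC k) (norm_nonneg c)

variable {ρ : Matrix.SpecialLinearGroup (Fin (m + 1)) ℝ →* Module.End ℝ V}

lemma rho_mul_apply (g h : Matrix.SpecialLinearGroup (Fin (m + 1)) ℝ) (x : V) :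
    ρ (g * h) x = ρ g (ρ h x) := by
  rw [map_mul, Module.End.mul_apply]

lemma rho_inv_apply (g : Matrix.SpecialLinearGroup (Fin (m + 1)) ℝ) (x : V) :
    ρ g⁻¹ (ρ g x) = x := by
  rw [← rho_mul_apply, inv_mul_cancel, map_one, Module.End.one_apply]

variable [FiniteDimensional ℝ V]

lemma exists_bound_rho {ι : Type*} {g : ι → Matrix.SpecialLinearGroup (Fin (m + 1)) ℝ} {x : V}
    (h : Matrix.SpecialLinearGroup (Fin (m + 1)) ℝ) (hx : ∃ C, ∀ k, ‖ρ (g k) x‖ ≤ C) :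
    ∃ C, ∀ k, ‖ρ (h * g k) x‖ ≤ C := by
  obtain ⟨C, hC⟩ := hx
  refine ⟨‖LinearMap.toContinuousLinearMap (ρ h)‖ * C, fun k => ?_⟩
  rw [rho_mul_apply]
  exact ((LinearMap.toContinuousLinearMap (ρ h)).le_opNorm _).trans
    (mul_le_mul_of_nonneg_left (hC k) (norm_nonneg _))

lemma rho_torSL_mem_torBounded {x : V} (hx : x ∈ torBounded ρ) (d : Fin (m + 1) → ℝ) :
    ρ (torSL d) x ∈ torBounded ρ := by
  intro i
  obtain ⟨C, hC⟩ := exists_bound_rho (torSL d) (hx i)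
  refine ⟨C, fun k => ?_⟩
  rw [← rho_mul_apply, ← torSL_add, add_comm (Pi.single i _) d, torSL_add]
  exact hC k

/-- By the uniform boundedness principle, orbits stay bounded along sums of coordinate
directions. -/
lemma exists_bound_torSL_sum {x : V} (hx : x ∈ torBounded ρ) (s : Finset (Fin (m + 1))) :
    ∃ C, ∀ k : ℕ, ‖ρ (torSL (∑ i ∈ s, Pi.single i (k : ℝ))) x‖ ≤ C := by
  classical
  induction s using Finset.induction_on with
  | empty => exact ⟨‖ρ (torSL 0) x‖, fun k => by simp⟩
  | insert i s hi ih =>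
    obtain ⟨C, hC⟩ := ih
    have : CompleteSpace (torBounded ρ) := FiniteDimensional.complete ℝ _
    obtain ⟨D, hD⟩ := banach_steinhaus (g := fun k : ℕ =>
      (LinearMap.toContinuousLinearMap (ρ (torSL (Pi.single i (k : ℝ))))).comp
        (torBounded ρ).subtypeL)
      fun y => y.2 i
    refine ⟨D * C, fun k => ?_⟩
    rw [Finset.sum_insert hi, torSL_add, rho_mul_apply]
    let y : torBounded ρ := ⟨_, rho_torSL_mem_torBounded hx (∑ j ∈ s, Pi.single j (k : ℝ))⟩
    exact (ContinuousLinearMap.le_of_opNorm_le _ (hD k) y).trans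
      (mul_le_mul_of_nonneg_left (hC k) ((norm_nonneg _).trans (hD k)))

lemma torSL_single_neg (i : Fin (m + 1)) (t : ℝ) :
    torSL (Pi.single i (-t)) = torSL (∑ j ∈ Finset.univ.erase i, Pi.single j t) := by
  have h : (∑ j ∈ Finset.univ.erase i, Pi.single j t : Fin (m + 1) → ℝ) =
      Pi.single i (-t) + fun _ => t := by
    rw [← Finset.univ_sum_single (fun _ : Fin (m + 1) => t),
      ← Finset.add_sum_erase _ _ (Finset.mem_univ i), Pi.single_neg, neg_add_cancel_left]
  rw [h, torSL_add, torSL_const, mul_one]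

lemma torSL_fixed_of_mem_torBounded (hss : (⨆ μ : ℝ, wtSpace m ρ μ) = ⊤) {x : V}
    (hx : x ∈ torBounded ρ) (d : Fin (m + 1) → ℝ) : ρ (torSL d) x = x := by
  have key : ∀ i t, ρ (torSL (Pi.single i t)) x = x := by
    intro i
    obtain ⟨g, hg⟩ := exists_conj_torSL_single i
    have hg' : ∀ t, aSL m t * g⁻¹ = g⁻¹ * torSL (Pi.single i t) := fun t => by
      rw [eq_inv_mul_iff_mul_eq, ← mul_assoc, ← hg, mul_inv_cancel_right]
    obtain ⟨C, hC⟩ := exists_bound_rho g⁻¹ (hx i)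
    obtain ⟨D, hD⟩ := exists_bound_rho g⁻¹ (exists_bound_torSL_sum hx (Finset.univ.erase i))
    have hmem : ρ g⁻¹ x ∈ wtSpace m ρ 0 := by
      refine mem_wtSpace_zero_of_bounded hss (C := max C D) (fun k => ?_) fun k => ?_
      · rw [← rho_mul_apply, hg']; exact (hC k).trans (le_max_left _ _)
      · rw [← rho_mul_apply, hg', torSL_single_neg]; exact (hD k).trans (le_max_right _ _)
    intro t
    have := congr_arg (ρ g) (mem_wtSpace_zero.1 hmem t)
    rw [← rho_mul_apply, ← rho_mul_apply, ← rho_mul_apply, mul_assoc, hg' t, mul_inv_cancel_left,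
      mul_inv_cancel, map_one, Module.End.one_apply] at this
    exact this
  have : ∀ s : Finset (Fin (m + 1)), ρ (torSL (∑ i ∈ s, Pi.single i (d i))) x = x := by
    classical
    intro s
    induction s using Finset.induction_on with
    | empty => simpa using key 0 0
    | insert i s hi ih => rw [Finset.sum_insert hi, torSL_add, rho_mul_apply, ih, key]
  simpa [Finset.univ_sum_single] using this Finset.univ

/-- If `v` and its translates along the coordinate axes converge to their projections under the
flow `a_t`, then the limit of `v` is fixed by the diagonal torus. -/
lemma torSL_fixed_of_tendsto (hss : (⨆ μ : ℝ, wtSpace m ρ μ) = ⊤)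
    (hcont : ∀ v : V, Continuous fun g => ρ g v) {π₀ : V →ₗ[ℝ] V} {v : V}
    (hv : Tendsto (fun t => ρ (aSL m t) v) atTop (𝓝 (π₀ v))) {l : Fin m → ℝ} (hl : ∀ i, l i ≠ 0)
    (hu : ∀ i, Tendsto (fun t => ρ (aSL m t) (ρ (uSL m (Pi.single i (l i))) v)) atTop
      (𝓝 (π₀ (ρ (uSL m (Pi.single i (l i))) v)))) :
    π₀ v = ρ (lowSL fun i => (l i)⁻¹) v ∧ ∀ d, ρ (torSL d) (π₀ v) = π₀ v := by
  set z : Fin m → ℝ := fun i => (l i)⁻¹ with hz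
  have hw := tendsto_aSL_lowSL hcont hv z
  have hbdd : ∀ {f : ℝ → V} {y : V}, Tendsto f atTop (𝓝 y) → ∃ C, ∀ k : ℕ, ‖f k‖ ≤ C := by
    intro f y hf
    obtain ⟨C, hC⟩ := (Metric.isBounded_range_of_tendsto _
      (hf.comp tendsto_natCast_atTop_atTop)).exists_norm_le
    exact ⟨C, fun k => hC _ ⟨k, rfl⟩⟩
  have hmem : ρ (lowSL z) v ∈ torBounded ρ := by
    intro i
    refine Fin.cases ?_ (fun i => ?_) i
    · simpa only [torSL_single_zero] using hbdd hw
    · set X := lowSL (-Pi.single i (l i)⁻¹) * uSL m (Pi.single i (l i)) * lowSL (-z)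
      have hX : ∀ t, torSL (Pi.single i.succ t) = X⁻¹ * (aSL m t * X) := fun t => by
        rw [aSL_mul_conj i t (l i) (hl i) (-z) (by simp [hz, hl i]), inv_mul_cancel_left]
      have hXw : ρ X (ρ (lowSL z) v) =
          ρ (lowSL (-Pi.single i (l i)⁻¹)) (ρ (uSL m (Pi.single i (l i))) v) := by
        rw [← rho_mul_apply, ← rho_mul_apply, mul_assoc, ← lowSL_add, neg_add_cancel, lowSL_zero,
          mul_one]
      simp only [hX]
      refine exists_bound_rho X⁻¹ ?_
      simp only [rho_mul_apply _ X, hXw]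
      exact hbdd (tendsto_aSL_lowSL hcont (hu i) _)
  have hfix := torSL_fixed_of_mem_torBounded hss hmem
  have hπ : π₀ v = ρ (lowSL z) v := by
    refine tendsto_nhds_unique hw ?_
    simp only [← torSL_single_zero, hfix]
    exact tendsto_const_nhds
  exact ⟨hπ, fun d => by rw [hπ, hfix]⟩

end TorusFixed

section SignChanges

open Filter Topology

variable {m : ℕ} {V : Type*} [NormedAddCommGroup V] [NormedSpace ℝ V] [FiniteDimensional ℝ V]
  {ρ : Matrix.SpecialLinearGroup (Fin (m + 1)) ℝ →* Module.End ℝ V}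

lemma uSL_zpow (ξ : Fin m → ℝ) (c : ℕ) : uSL m ξ ^ (c : ℤ) = uSL m ((c : ℝ) • ξ) := by
  rw [zpow_natCast]
  induction c with
  | zero => simp [uSL_zero]
  | succ c ih => rw [pow_succ, ih, ← uSL_add, Nat.cast_succ, add_smul, one_smul]

lemma lowSL_zpow (y : Fin m → ℝ) (c : ℕ) : lowSL y ^ (c : ℤ) = lowSL ((c : ℝ) • y) := by
  rw [zpow_natCast]
  induction c with
  | zero => simp [lowSL_zero]
  | succ c ih => rw [pow_succ, ih, ← lowSL_add, Nat.cast_succ, add_smul, one_smul]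

lemma lowSL_neg (y : Fin m → ℝ) : lowSL (-y) = (lowSL y)⁻¹ := by
  rw [eq_inv_iff_mul_eq_one, ← lowSL_add, neg_add_cancel, lowSL_zero]

lemma rho_lowSL_sub_one_pow (hcont : ∀ v : V, Continuous fun g => ρ g v) (y : Fin m → ℝ) :
    (ρ (lowSL y) - 1) ^ Module.finrank ℝ V = 0 :=
  rho_sub_one_pow_finrank hcont (fun t => aSL_mul_lowSL t y)
    (tendsto_lowSL (tendsto_exp_neg_succ_mul m) y)

lemma rho_uSL_sub_one_pow (hcont : ∀ v : V, Continuous fun g => ρ g v) (ξ : Fin m → ℝ) :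
    (ρ (uSL m ξ) - 1) ^ Module.finrank ℝ V = 0 := by
  refine rho_sub_one_pow_finrank (l := atTop) hcont (fun t : ℝ => aSL_mul_uSL (-t) ξ) ?_
  simp only [mul_neg]
  exact tendsto_uSL (tendsto_exp_neg_succ_mul m) ξ

/-- The square of a Weyl element fixes the vectors fixed by the positive diagonal torus. -/
lemma rho_weylSL_sq (hss : (⨆ μ : ℝ, wtSpace m ρ μ) = ⊤)
    (hcont : ∀ v : V, Continuous fun g => ρ g v) {π₀ : V →ₗ[ℝ] V}
    (hπ₀ : ∀ w ∈ wtSpace m ρ 0, π₀ w = w)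
    (hπ : ∀ μ : ℝ, μ ≠ 0 → ∀ w ∈ wtSpace m ρ μ, π₀ w = 0) {x : V}
    (hx : ∀ d, ρ (torSL d) x = x) (i : Fin m) : ρ (weylSL i * weylSL i) x = x := by
  have hax : ∀ t, ρ (aSL m t) x = x := fun t => torSL_single_zero t ▸ hx _
  set ξ : Fin m → ℝ := Pi.single i 1
  have hk : weylSL i = uSL m ξ * (lowSL ξ)⁻¹ * uSL m ξ := by rw [weylSL, lowSL_neg]
  have hk' : (weylSL i)⁻¹ = (uSL m ξ)⁻¹ * lowSL ξ * (uSL m ξ)⁻¹ := by rw [hk]; group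
  have hconj : ∀ c : ℕ, 1 ≤ c → aSL m (Real.log c / (m + 1)) *
      (uSL m ξ * lowSL ξ ^ (c : ℤ) * uSL m ξ) =
        uSL m ξ ^ (c : ℤ) * lowSL ξ * uSL m ξ ^ (c : ℤ) * aSL m (Real.log c / (m + 1)) := by
    intro c hc
    have hc0 : (0 : ℝ) < c := by exact_mod_cast hc
    have hm : (m + 1 : ℝ) * (Real.log c / (m + 1)) = Real.log c := by field_simp
    rw [uSL_zpow, lowSL_zpow, mul_assoc (uSL m ξ), ← mul_assoc, aSL_mul_uSL, mul_assoc,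
      ← mul_assoc (aSL m _), aSL_mul_lowSL, mul_assoc, aSL_mul_uSL, hm, Real.exp_neg,
      Real.exp_log hc0, inv_smul_smul₀ hc0.ne']
    simp only [mul_assoc]
  have hwt : ρ (weylSL i) x ∈ wtSpace m ρ 0 := mem_wtSpace_zero.2 fun t => by
    rw [← rho_mul_apply, aSL_mul_weylSL, rho_mul_apply, hx]
  have hwt' : ρ (weylSL i)⁻¹ x ∈ wtSpace m ρ 0 := mem_wtSpace_zero.2 fun t => by
    have : aSL m t * (weylSL i)⁻¹ = (weylSL i)⁻¹ * torSL (Pi.single i.succ t) := by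
      rw [eq_inv_mul_iff_mul_eq, ← mul_assoc, ← torSL_single_succ_mul_weylSL,
        mul_inv_cancel_right]
    rw [← rho_mul_apply, this, rho_mul_apply, hx]
  have heq : ρ (weylSL i)⁻¹ x = ρ (weylSL i) x := by
    rw [← sub_eq_zero, ← Module.forall_dual_apply_eq_zero_iff ℝ]
    intro ψ
    have := coeff_eq_of_unipotent (rho_uSL_sub_one_pow hcont ξ) (rho_lowSL_sub_one_pow hcont ξ)
      (ψ ∘ₗ π₀) x fun c hc => by
        nth_rw 1 [← hax (Real.log c / (m + 1))]
        rw [← rho_mul_apply, ← hconj c hc, rho_mul_apply, LinearMap.comp_apply,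
          pi0_rho hss hπ₀ hπ (fun s => by
            rw [← aSL_add, ← aSL_add, add_comm s]),
          mem_wtSpace_zero.1 (pi0_mem_wtSpace_zero hss hπ₀ hπ _), LinearMap.comp_apply]
    rw [← hk, ← hk', LinearMap.comp_apply, LinearMap.comp_apply, hπ₀ _ hwt, hπ₀ _ hwt'] at this
    rw [map_sub, this, sub_self]
  rw [rho_mul_apply, ← heq, ← rho_mul_apply, mul_inv_cancel, map_one, Module.End.one_apply]

end SignChanges

section LeviFixed

variable {m : ℕ}

lemma weylSL_mul_self (i : Fin m)
    (h : (Matrix.diagonal (Pi.mulSingle i (-1 : ℝ))).det ≠ 0) :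
    weylSL i * weylSL i = leviSL (Matrix.diagonal (Pi.mulSingle i (-1))) h := by
  apply Subtype.ext
  simp only [Matrix.SpecialLinearGroup.coe_mul, coe_weylSL, coe_leviSL, blk_mul, blk_inj,
    one_sub_single]
  refine ⟨?_, ?_, ?_, ?_⟩
  · simp [Matrix.det_diagonal]
  · ext j
    by_cases hj : j = i
    · subst hj; simp
    · simp
  · ext j
    by_cases hj : j = i
    · subst hj; simp [Matrix.mulVec_diagonal]
    · simp [hj, Matrix.mulVec_diagonal]
  · ext j k
    by_cases hj : j = i <;> by_cases hk : k = i <;> by_cases hjk : j = k <;>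
      simp_all [Matrix.vecMulVec_apply]

lemma leviSL_diagonal_eq_torSL (c : Fin m → ℝ) (hc : ∀ j, 0 < c j)
    (h : (Matrix.diagonal c).det ≠ 0) : ∃ d, leviSL (Matrix.diagonal c) h = torSL d := by
  refine ⟨Fin.cons (-(∑ j, Real.log (c j)) / (m + 1)) fun j => Real.log (c j) / (m + 1), ?_⟩
  apply Subtype.ext
  have hm : (m + 1 : ℝ) ≠ 0 := by positivity
  have hsum : ∑ i, (Fin.cons (-(∑ j, Real.log (c j)) / (m + 1))
      (fun j => Real.log (c j) / (m + 1)) : Fin (m + 1) → ℝ) i = 0 := by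
    rw [Fin.sum_univ_succ]
    simp only [Fin.cons_zero, Fin.cons_succ, ← Finset.sum_div]
    ring
  rw [coe_leviSL, coe_torSL, hsum, blk_inj]
  refine ⟨?_, rfl, rfl, ?_⟩
  · rw [Fin.cons_zero, sub_zero, mul_div_cancel₀ _ hm, Real.exp_neg, Real.exp_sum,
      Matrix.det_diagonal]
    simp only [Real.exp_log (hc _)]
  · congr 1
    ext j
    rw [Fin.cons_succ, sub_zero, mul_div_cancel₀ _ hm, Real.exp_log (hc j)]

variable {V : Type*} [NormedAddCommGroup V] [NormedSpace ℝ V]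
  {ρ : Matrix.SpecialLinearGroup (Fin (m + 1)) ℝ →* Module.End ℝ V}

lemma leviSL_fixed_mul {A B : Matrix (Fin m) (Fin m) ℝ} {x : V}
    (hA : ∀ h, ρ (leviSL A h) x = x) (hB : ∀ h, ρ (leviSL B h) x = x)
    (h : (A * B).det ≠ 0) : ρ (leviSL (A * B) h) x = x := by
  have h' := h
  rw [Matrix.det_mul] at h'
  rw [leviSL_mul A B (left_ne_zero_of_mul h') (right_ne_zero_of_mul h'), rho_mul_apply, hB, hA]

lemma leviSL_diagonal_fixed {x : V} (hx : ∀ d, ρ (torSL d) x = x)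
    (hsq : ∀ i : Fin m, ρ (weylSL i * weylSL i) x = x) (c : Fin m → ℝ)
    (h : (Matrix.diagonal c).det ≠ 0) : ρ (leviSL (Matrix.diagonal c) h) x = x := by
  classical
  have hc : ∀ j, c j ≠ 0 := by
    simpa [Matrix.det_diagonal, Finset.prod_eq_zero_iff] using h
  have hsign : ∀ s : Finset (Fin m), ∀ h,
      ρ (leviSL (Matrix.diagonal (∏ i ∈ s, Pi.mulSingle i (-1))) h) x = x := by
    intro s
    induction s using Finset.induction_on with
    | empty =>
      intro h
      obtain ⟨d, hd⟩ := leviSL_diagonal_eq_torSL _ (by simp) h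
      rw [hd, hx]
    | insert i s hi ih =>
      rw [Finset.prod_insert hi, Pi.mul_def, ← Matrix.diagonal_mul_diagonal]
      exact leviSL_fixed_mul (fun h => by rw [← weylSL_mul_self, hsq]) ih
  have habs : ∀ h, ρ (leviSL (Matrix.diagonal |c|) h) x = x := by
    intro h
    obtain ⟨d, hd⟩ := leviSL_diagonal_eq_torSL |c| (fun j => abs_pos.2 (hc j)) h
    rw [hd, hx]
  have hprod : Matrix.diagonal c =
      Matrix.diagonal (∏ i with c i < 0, Pi.mulSingle i (-1)) * Matrix.diagonal |c| := by
    rw [Matrix.diagonal_mul_diagonal]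
    congr 1
    ext j
    rw [Finset.prod_apply, Pi.abs_apply]
    by_cases hj : c j < 0
    · rw [Finset.prod_eq_single_of_mem j (by simpa using hj)
        fun i _ hij => Pi.mulSingle_eq_of_ne hij.symm _, Pi.mulSingle_eq_same, abs_of_neg hj]
      ring
    · rw [Finset.prod_eq_one, abs_of_nonneg (not_lt.1 hj), one_mul]
      rintro i hi
      refine Pi.mulSingle_eq_of_ne (fun hij => hj ?_) _
      rw [hij]
      exact (Finset.mem_filter.1 hi).2
  revert h
  rw [hprod]
  exact leviSL_fixed_mul (hsign _) habs

end LeviFixed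

section Shear

open Filter Topology

variable {m : ℕ}

/-- The identity matrix with the row vector `r` added to its `k`-th row. -/
def shear (k : Fin m) (r : Fin m → ℝ) : Matrix (Fin m) (Fin m) ℝ :=
  1 + Matrix.vecMulVec (Pi.single k 1) r

lemma det_shear {k : Fin m} {r : Fin m → ℝ} (hr : r k = 0) : (shear k r).det = 1 := by
  rw [shear, Matrix.vecMulVec_eq Unit, Matrix.det_one_add_replicateCol_mul_replicateRow]
  simp [hr]

lemma vecMul_shear (η : Fin m → ℝ) (k : Fin m) (r : Fin m → ℝ) :
    η ᵥ* shear k r = η + η k • r := by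
  rw [shear, Matrix.vecMul_add, Matrix.vecMul_one, Matrix.vecMul_vecMulVec, dotProduct_single_one]

lemma shear_mul_transvection {k : Fin m} {r : Fin m → ℝ} (hr : r k = 0) (j : Fin m) (z : ℝ) :
    shear k r * Matrix.transvection k j z = shear k (r + Pi.single j z) := by
  have h : Matrix.single k j z = Matrix.vecMulVec (Pi.single k 1) (Pi.single j z) := by
    ext p q
    simp [Matrix.single_apply, Matrix.vecMulVec_apply, Pi.single_apply, ← ite_and, and_comm,
      eq_comm]
  rw [shear, shear, Matrix.transvection, h, mul_add, mul_one, add_mul, one_mul,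
    Matrix.vecMulVec_mul_vecMulVec]
  simp [hr, Matrix.vecMulVec_add, add_assoc]

lemma diagonal_mul_shear {k : Fin m} {r s c : Fin m → ℝ} (hc : ∀ j, c k * r j = s j * c j) :
    Matrix.diagonal c * shear k r = shear k s * Matrix.diagonal c := by
  ext p q
  simp only [shear, Matrix.diagonal_mul, Matrix.mul_diagonal, Matrix.add_apply,
    Matrix.vecMulVec_apply, mul_add, add_mul]
  congr 1
  · by_cases h : p = q
    · rw [h, mul_comm]
    · simp [Matrix.one_apply_ne h]
  · by_cases h : p = k
    · subst h; simp [hc]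
    · simp [h]

variable {V : Type*} [NormedAddCommGroup V] [NormedSpace ℝ V]
  {ρ : Matrix.SpecialLinearGroup (Fin (m + 1)) ℝ →* Module.End ℝ V}

/-- If a shear maps a vector fixed by the diagonal matrices to another such vector, then the
transvections along its support fix the vector. -/
lemma leviSL_transvection_fixed {k j : Fin m} (hkj : k ≠ j) {r : Fin m → ℝ} (hrk : r k = 0)
    (hrj : r j ≠ 0) {x : V} (hx : ∀ c h, ρ (leviSL (Matrix.diagonal c) h) x = x)
    (hS : (shear k r).det ≠ 0)
    (hSx : ∀ c h, ρ (leviSL (Matrix.diagonal c) h) (ρ (leviSL (shear k r) hS) x) =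
      ρ (leviSL (shear k r) hS) x) (z : ℝ) (h : (Matrix.transvection k j z).det ≠ 0) :
    ρ (leviSL (Matrix.transvection k j z) h) x = x := by
  have generic : ∀ z, r j + z ≠ 0 → ∀ h, ρ (leviSL (Matrix.transvection k j z) h) x = x := by
    intro z hz h
    set c : Fin m → ℝ := Pi.mulSingle j (r j / (r j + z))
    have hc : (Matrix.diagonal c).det ≠ 0 := by
      rw [Matrix.det_diagonal, Finset.prod_pi_mulSingle', if_pos (Finset.mem_univ j)]
      exact div_ne_zero hrj hz
    have hmul : Matrix.diagonal c * shear k r =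
        shear k r * Matrix.transvection k j z * Matrix.diagonal c := by
      rw [shear_mul_transvection hrk]
      refine diagonal_mul_shear fun i => ?_
      by_cases hi : i = j
      · subst hi
        simp only [c, Pi.mulSingle_eq_of_ne hkj, Pi.add_apply, Pi.single_eq_same,
          Pi.mulSingle_eq_same]
        field_simp
      · simp [c, hi, hkj]
    have hlevi : leviSL (Matrix.diagonal c) hc * leviSL (shear k r) hS =
        leviSL (shear k r) hS * leviSL (Matrix.transvection k j z) h *
          leviSL (Matrix.diagonal c) hc := by
      rw [← leviSL_mul _ _ hS h (by rw [Matrix.det_mul]; exact mul_ne_zero hS h),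
        ← leviSL_mul _ _ hc hS (by rw [Matrix.det_mul]; exact mul_ne_zero hc hS),
        ← leviSL_mul _ _ _ hc (by rw [← hmul, Matrix.det_mul]; exact mul_ne_zero hc hS)]
      congr 1
    have := hSx c hc
    rw [← rho_mul_apply, hlevi, rho_mul_apply, rho_mul_apply, hx] at this
    have := congr_arg (ρ (leviSL (shear k r) hS)⁻¹) this
    rwa [rho_inv_apply, rho_inv_apply] at this
  by_cases hz : r j + z = 0
  · have h₂ : r j + z / 2 ≠ 0 := by
      intro h₂
      apply hrj
      linarith
    revert h
    rw [← add_halves z, ← Matrix.transvection_mul_transvection_same _ _ hkj]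
    exact leviSL_fixed_mul (generic _ h₂) (generic _ h₂)
  · exact generic z hz h

variable [FiniteDimensional ℝ V]

/-- The flow `a_t` takes `v` to its projection. -/
def FlowTendsto (ρ : Matrix.SpecialLinearGroup (Fin (m + 1)) ℝ →* Module.End ℝ V)
    (π₀ : V →ₗ[ℝ] V) (v : V) : Prop :=
  Tendsto (fun t => ρ (aSL m t) v) atTop (𝓝 (π₀ v))

variable {π₀ : V →ₗ[ℝ] V}

lemma FlowTendsto.rho_leviSL (hss : (⨆ μ : ℝ, wtSpace m ρ μ) = ⊤)
    (hcont : ∀ v : V, Continuous fun g => ρ g v) (hπ₀ : ∀ w ∈ wtSpace m ρ 0, π₀ w = w)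
    (hπ : ∀ μ : ℝ, μ ≠ 0 → ∀ w ∈ wtSpace m ρ μ, π₀ w = 0) {v : V} (hv : FlowTendsto ρ π₀ v)
    (D : Matrix (Fin m) (Fin m) ℝ) (h : D.det ≠ 0) : FlowTendsto ρ π₀ (ρ (leviSL D h) v) := by
  have := tendsto_rho_apply hcont (tendsto_const_nhds (x := leviSL D h)) hv
  rw [FlowTendsto, pi0_rho hss hπ₀ hπ (leviSL_mul_aSL D h)]
  simpa only [← rho_mul_apply, leviSL_mul_aSL] using this

/-- If `v`, its translates along all coordinate axes and one generic translate converge to their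
projections, then the limit of `v` is fixed by all invertible block matrices. -/
lemma leviSL_fixed_of_flowTendsto (hss : (⨆ μ : ℝ, wtSpace m ρ μ) = ⊤)
    (hcont : ∀ v : V, Continuous fun g => ρ g v) (hπ₀ : ∀ w ∈ wtSpace m ρ 0, π₀ w = w)
    (hπ : ∀ μ : ℝ, μ ≠ 0 → ∀ w ∈ wtSpace m ρ μ, π₀ w = 0) {v : V} (hv : FlowTendsto ρ π₀ v)
    {l : ℝ} (hl : l ≠ 0) (hu : ∀ i, FlowTendsto ρ π₀ (ρ (uSL m (Pi.single i l)) v))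
    {ξ : Fin m → ℝ} (hξ : ∀ i, ξ i ≠ 0) (huξ : FlowTendsto ρ π₀ (ρ (uSL m ξ) v))
    (A : Matrix (Fin m) (Fin m) ℝ) (hA : A.det ≠ 0) : ρ (leviSL A hA) (π₀ v) = π₀ v := by
  have diag : ∀ {x : V}, (∀ d, ρ (torSL d) x = x) →
      ∀ c h, ρ (leviSL (Matrix.diagonal c) h) x = x := fun hx =>
    leviSL_diagonal_fixed hx (rho_weylSL_sq hss hcont hπ₀ hπ hx)
  have hx := diag (torSL_fixed_of_tendsto hss hcont hv (fun _ => hl) hu).2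
  have htrans : ∀ t : Matrix.TransvectionStruct (Fin m) ℝ, ∀ h,
      ρ (leviSL t.toMatrix h) (π₀ v) = π₀ v := by
    rintro ⟨k, j, hkj, z⟩ h
    set r : Fin m → ℝ := Function.update (fun i => ξ i / ξ k) k 0
    have hrk : r k = 0 := by simp [r]
    have hrj : r j ≠ 0 := by simpa [r, hkj.symm] using ⟨hξ j, hξ k⟩
    have hS : (shear k r).det ≠ 0 := by rw [det_shear hrk]; exact one_ne_zero
    refine leviSL_transvection_fixed hkj hrk hrj hx hS ?_ z h
    have hcomm : ∀ ζ η, ζ = η + η k • r → ρ (uSL m η) (ρ (leviSL (shear k r) hS) v) =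
        ρ (leviSL (shear k r) hS) (ρ (uSL m ζ) v) := fun ζ η h => by
      rw [← rho_mul_apply, ← rho_mul_apply, leviSL_mul_uSL _ hS ζ η]
      rw [det_shear hrk, inv_one, one_smul, vecMul_shear, h]
    rw [← pi0_rho hss hπ₀ hπ (leviSL_mul_aSL _ hS)]
    refine diag (torSL_fixed_of_tendsto hss hcont (hv.rho_leviSL hss hcont hπ₀ hπ _ hS)
      (l := Function.update (fun _ => l) k (ξ k)) (fun i => ?_) fun i => ?_).2
    · by_cases hi : i = k
      · subst hi; simpa using hξ i
      · simpa [hi] using hl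
    · by_cases hi : i = k
      · subst hi
        rw [Function.update_self, hcomm ξ]
        · exact huξ.rho_leviSL hss hcont hπ₀ hπ _ hS
        · ext j
          by_cases hj : j = i
          · subst hj; simp [r]
          · simp [r, hj, mul_div_cancel₀ _ (hξ i)]
      · rw [Function.update_of_ne hi, hcomm (Pi.single i l)]
        · exact (hu i).rho_leviSL hss hcont hπ₀ hπ _ hS
        · simp [Ne.symm hi]
  exact Matrix.diagonal_transvection_induction_of_det_ne_zero
    (fun A => ∀ h, ρ (leviSL A h) (π₀ v) = π₀ v) A hA (fun c _ => hx c) htrans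
    (fun A B _ _ hA hB => leviSL_fixed_mul hA hB) hA

end Shear

lemma exists_eq_leviSL {m : ℕ} {g : Matrix.SpecialLinearGroup (Fin (m + 1)) ℝ}
    (hg : ∀ t, g * aSL m t = aSL m t * g) : ∃ D h, g = leviSL D h := by
  obtain ⟨a, r, c, D, hM⟩ : ∃ a r c D, (g : Matrix (Fin (m + 1)) (Fin (m + 1)) ℝ) = blk a r c D :=
    ⟨_, _, _, _, eq_blk _⟩
  have h := congr_arg Subtype.val (hg 1)
  simp only [Matrix.SpecialLinearGroup.coe_mul, coe_aSL, hM, blk_mul, blk_inj] at h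
  have hne : Real.exp (m * 1) - Real.exp (-1) ≠ 0 := by
    rw [sub_ne_zero, Ne, Real.exp_eq_exp]
    have : (0 : ℝ) ≤ m := m.cast_nonneg
    linarith
  have hr : r = 0 := by
    have h₁ : Real.exp (-1) • r = Real.exp (m * 1) • r := by
      simpa [Matrix.vecMul_smul] using h.2.1
    have : (Real.exp (m * 1) - Real.exp (-1)) • r = 0 := by rw [sub_smul, h₁, sub_self]
    exact (smul_eq_zero.1 this).resolve_left hne
  have hc : c = 0 := by
    have h₁ : Real.exp (m * 1) • c = Real.exp (-1) • c := by
      simpa [Matrix.smul_mulVec] using h.2.2.1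
    have : (Real.exp (m * 1) - Real.exp (-1)) • c = 0 := by rw [sub_smul, h₁, sub_self]
    exact (smul_eq_zero.1 this).resolve_left hne
  subst hr hc
  have hdet : a * D.det = 1 := by rw [← det_blk_lower a 0 D, ← hM, g.2]
  refine ⟨D, right_ne_zero_of_mul_eq_one hdet, Subtype.ext ?_⟩
  rw [hM, coe_leviSL, eq_inv_of_mul_eq_one_left hdet]

lemma exists_basis_mem_of_not_subset_iUnion {m : ℕ} (hm : 1 ≤ m) {S : Set (Fin m → ℝ)}
    (hS : ¬ ∃ W : Fin m → Submodule ℝ (Fin m → ℝ), (∀ i, W i ≠ ⊤) ∧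
      S ⊆ ⋃ i, (W i : Set (Fin m → ℝ))) :
    ∃ b : Module.Basis (Fin m) ℝ (Fin m → ℝ), (∀ i, b i ∈ S) ∧ ∃ ξ ∈ S, ∀ i, b.repr ξ i ≠ 0 := by
  have hspan : Submodule.span ℝ S = ⊤ := by
    by_contra h
    exact hS ⟨fun _ => Submodule.span ℝ S, fun _ => h,
      Submodule.subset_span.trans (Set.subset_iUnion_of_subset ⟨0, hm⟩ subset_rfl)⟩
  let b₀ := Module.Basis.ofSpan hspan.ge
  let b := b₀.reindex (b₀.indexEquiv (Pi.basisFun ℝ (Fin m)))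
  have hb : ∀ i, b i ∈ S := fun i => by
    rw [Module.Basis.reindex_apply]
    exact Module.Basis.ofSpan_subset hspan.ge ⟨_, rfl⟩
  refine ⟨b, hb, ?_⟩
  by_contra! h
  refine hS ⟨fun i => LinearMap.ker (b.coord i), fun i hi => ?_, fun ξ hξ => ?_⟩
  · simpa using LinearMap.congr_fun (LinearMap.ker_eq_top.1 hi) (b i)
  · obtain ⟨i, hi⟩ := h ξ hξ
    exact Set.mem_iUnion.2 ⟨i, hi⟩

/-- Corollary 4.4 of the paper. Let `E ⊆ ℝ^{n-1}` and `e ∈ E` be such that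
`E_e = {e' - e : e' ∈ E}` is not contained in a union of `n-1` proper linear
subspaces of `ℝ^{n-1}`. If `v ∈ V` satisfies `u(e') v ∈ V⁰ + V⁻` for all `e' ∈ E`,
then `π₀(u(e) v) ≠ 0`, and `π₀(u(e) v)` is fixed by the full centralizer `Z(A)`
of `A = {a_t}` in `SL(n, ℝ)`. -/
theorem pi0_fixed_by_centralizer {m : ℕ} (hm : 1 ≤ m)
    {V : Type*} [NormedAddCommGroup V] [NormedSpace ℝ V] [FiniteDimensional ℝ V]
    (ρ : Matrix.SpecialLinearGroup (Fin (m + 1)) ℝ →* Module.End ℝ V)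
    (hcont : ∀ v : V, Continuous fun g => ρ g v)
    (hss : (⨆ μ : ℝ, wtSpace m ρ μ) = ⊤)
    (π₀ : V →ₗ[ℝ] V)
    (hπ₀ : ∀ w ∈ wtSpace m ρ 0, π₀ w = w)
    (hπ : ∀ μ : ℝ, μ ≠ 0 → ∀ w ∈ wtSpace m ρ μ, π₀ w = 0)
    (E : Set (Fin m → ℝ)) (e : Fin m → ℝ) (he : e ∈ E)
    (hE : ¬ ∃ W : Fin m → Submodule ℝ (Fin m → ℝ), (∀ i, W i ≠ ⊤) ∧
      (fun e' => e' - e) '' E ⊆ ⋃ i, (W i : Set (Fin m → ℝ)))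
    (v : V) (hv0 : v ≠ 0)
    (hneg : ∀ e' ∈ E,
      ρ (uSL m e') v ∈ wtSpace m ρ 0 ⊔ ⨆ μ ∈ Set.Iio (0 : ℝ), wtSpace m ρ μ) :
    π₀ (ρ (uSL m e) v) ≠ 0 ∧
      ∀ g : Matrix.SpecialLinearGroup (Fin (m + 1)) ℝ,
        (∀ t : ℝ, g * aSL m t = aSL m t * g) →
        ρ g (π₀ (ρ (uSL m e) v)) = π₀ (ρ (uSL m e) v) := by
  set v₁ := ρ (uSL m e) v
  have hlim : ∀ ξ ∈ (fun e' => e' - e) '' E, FlowTendsto ρ π₀ (ρ (uSL m ξ) v₁) := by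
    rintro _ ⟨e', he', rfl⟩
    rw [← rho_mul_apply, ← uSL_add, sub_add_cancel]
    exact tendsto_aSL_of_mem hπ₀ hπ (hneg e' he')
  have hv₁ : FlowTendsto ρ π₀ v₁ := tendsto_aSL_of_mem hπ₀ hπ (hneg e he)
  obtain ⟨b, hb, ξ, hξ, hbξ⟩ := exists_basis_mem_of_not_subset_iUnion hm hE
  let B : Matrix (Fin m) (Fin m) ℝ := Matrix.of b
  have hB : B.det ≠ 0 := by
    rw [← isUnit_iff_ne_zero, ← Matrix.isUnit_iff_isUnit_det,
      ← Matrix.linearIndependent_rows_iff_isUnit]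
    exact b.linearIndependent
  have hrepr : ∀ ζ, b.repr ζ ᵥ* B = ζ := fun ζ => by
    rw [Matrix.vecMul_eq_sum]
    exact b.sum_repr ζ
  have hlim' : ∀ ζ ∈ (fun e' => e' - e) '' E,
      FlowTendsto ρ π₀ (ρ (uSL m (B.det⁻¹ • b.repr ζ)) (ρ (leviSL B hB) v₁)) := fun ζ hζ => by
    rw [← rho_mul_apply, ← leviSL_mul_uSL B hB ζ, rho_mul_apply]
    · exact (hlim ζ hζ).rho_leviSL hss hcont hπ₀ hπ B hB
    · rw [Matrix.smul_vecMul, hrepr]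
  have hB' := inv_ne_zero hB
  have hv₂ := hv₁.rho_leviSL hss hcont hπ₀ hπ B hB
  have haxes : ∀ i, FlowTendsto ρ π₀ (ρ (uSL m (Pi.single i B.det⁻¹)) (ρ (leviSL B hB) v₁)) := by
    intro i
    have := hlim' _ (hb i)
    rwa [b.repr_self, Finsupp.single_eq_pi_single, ← Pi.single_smul, smul_eq_mul, mul_one] at this
  have hcomm := pi0_rho hss hπ₀ hπ (leviSL_mul_aSL B hB)
  constructor
  · intro h0
    have h := (torSL_fixed_of_tendsto hss hcont hv₂ (fun _ => hB') haxes).1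
    rw [hcomm, h0, map_zero, ← rho_mul_apply, ← rho_mul_apply] at h
    apply hv0
    rw [← rho_inv_apply (ρ := ρ) _ v, ← h, map_zero]
  · intro g hg
    obtain ⟨D, hD, rfl⟩ := exists_eq_leviSL hg
    have hA : (B * D * B⁻¹).det ≠ 0 := by
      rwa [Matrix.det_conj ((Matrix.isUnit_iff_isUnit_det B).2 (isUnit_iff_ne_zero.2 hB))]
    have hfix := leviSL_fixed_of_flowTendsto hss hcont hπ₀ hπ hv₂ hB' haxes
      (fun i => mul_ne_zero hB' (hbξ i)) (hlim' ξ hξ) (B * D * B⁻¹) hA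
    have hAB : B * D * B⁻¹ * B = B * D :=
      Matrix.nonsing_inv_mul_cancel_right _ _ (isUnit_iff_ne_zero.2 hB)
    have hBD : (B * D).det ≠ 0 := by rw [Matrix.det_mul]; exact mul_ne_zero hB hD
    have hconj : leviSL (B * D * B⁻¹) hA * leviSL B hB = leviSL B hB * leviSL D hD := by
      rw [← leviSL_mul B D hB hD hBD, ← leviSL_mul _ _ hA hB (by rwa [hAB])]
      congr 1
    rw [hcomm, ← rho_mul_apply, hconj, rho_mul_apply] at hfix
    simpa only [rho_inv_apply] using congr_arg (ρ (leviSL B hB)⁻¹) hfix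
end
end

section
/- Let φ: [a,b] → ℝ^{n−1} be a differentiable curve whose image is not contained in a proper affine subspace of ℝ^{n−1}, V a finite-dimensional linear representation of G = SL(n,ℝ), and v ∈ V nonzero with u(φ(s))v ∈ V⁰ + V⁻ for all s ∈ [a,b]. Then v is fixed by G. -/
noncomputable section

open Matrix

variable {V : Type*} [AddCommGroup V] [Module ℝ V]

open Filter Topology

section Torus

variable {m : ℕ}

/-- The diagonal matrix with entries `exp (w j)`, normalised to have determinant one. -/
def torus (w : Fin (m + 1) → ℝ) : Matrix.SpecialLinearGroup (Fin (m + 1)) ℝ :=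
  ⟨Matrix.diagonal fun j => Real.exp (w j - (∑ k, w k) / (m + 1)), by
    rw [Matrix.det_diagonal, ← Real.exp_sum, Real.exp_eq_one_iff, Finset.sum_sub_distrib,
      Finset.sum_const, Finset.card_univ, Fintype.card_fin, nsmul_eq_mul]
    push_cast
    field_simp
    ring⟩

lemma torus_coe (w : Fin (m + 1) → ℝ) :
    (torus w : Matrix (Fin (m + 1)) (Fin (m + 1)) ℝ) =
      Matrix.diagonal fun j => Real.exp (w j - (∑ k, w k) / (m + 1)) := rfl

lemma torus_add (w w' : Fin (m + 1) → ℝ) : torus (w + w') = torus w * torus w' := by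
  apply Subtype.ext
  simp only [Matrix.SpecialLinearGroup.coe_mul, torus_coe, Matrix.diagonal_mul_diagonal,
    ← Real.exp_add, Pi.add_apply, Finset.sum_add_distrib]
  congr! 3
  ring

lemma torus_zero : torus (0 : Fin (m + 1) → ℝ) = 1 := by
  apply Subtype.ext
  simp [torus_coe]

lemma torus_neg (w : Fin (m + 1) → ℝ) : torus (-w) = (torus w)⁻¹ := by
  rw [eq_inv_iff_mul_eq_one, ← torus_add, neg_add_cancel, torus_zero]

lemma torus_congr {w w' : Fin (m + 1) → ℝ} (c : ℝ) (h : ∀ j, w j = w' j + c) :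
    torus w = torus w' := by
  apply Subtype.ext
  simp only [torus_coe, h, Finset.sum_add_distrib, Finset.sum_const, Finset.card_univ,
    Fintype.card_fin, nsmul_eq_mul]
  congr! 3
  push_cast
  field_simp
  ring

lemma aSL_eq_torus (t : ℝ) : aSL m t = torus (Pi.single 0 ((m + 1) * t)) := by
  apply Subtype.ext
  rw [torus_coe]
  simp only [aSL, aMat]
  congr 1
  ext j
  rw [Finset.sum_pi_single']
  refine Fin.cases ?_ (fun j => ?_) j
  · simp only [Fin.cons_zero, Pi.single_eq_same, Finset.mem_univ, if_true]
    congr 1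
    field_simp
    ring
  · simp only [Fin.cons_succ, Finset.mem_univ, if_true]
    rw [Pi.single_eq_of_ne (Fin.succ_ne_zero j)]
    congr 1
    field_simp
    ring

/-- Conjugation by a torus element rescales the entries of a matrix. -/
lemma torus_conj_apply (w : Fin (m + 1) → ℝ) (g : Matrix.SpecialLinearGroup (Fin (m + 1)) ℝ)
    (i j : Fin (m + 1)) : (torus w * g * (torus w)⁻¹) i j = Real.exp (w i - w j) * g i j := by
  rw [← torus_neg, Matrix.SpecialLinearGroup.coe_mul, Matrix.SpecialLinearGroup.coe_mul, torus_coe,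
    torus_coe, Matrix.mul_diagonal, Matrix.diagonal_mul, mul_right_comm, ← Real.exp_add]
  congr 2
  simp only [Pi.neg_apply, Finset.sum_neg_distrib]
  ring

/-- A signed permutation matrix carrying the `i`-th coordinate torus to the `0`-th one. -/
lemma exists_weyl (i : Fin (m + 1)) : ∃ (σ : Matrix.SpecialLinearGroup (Fin (m + 1)) ℝ) (c : ℝ),
    (∀ g : Matrix.SpecialLinearGroup (Fin (m + 1)) ℝ, (σ * g) 0 = c • g i) ∧
    ∀ t, torus (Pi.single 0 t) * σ = σ * torus (Pi.single i t) := by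
  set e := Equiv.swap 0 i
  set d : Fin (m + 1) → ℝ := fun k => if k = 0 then ((Equiv.Perm.sign e : ℤ) : ℝ) else 1
  have hdet : (Matrix.diagonal d * e.permMatrix ℝ).det = 1 := by
    rw [Matrix.det_mul, Matrix.det_diagonal, Matrix.det_permutation, Fin.prod_univ_succ]
    simp only [d, if_true, Fin.succ_ne_zero, if_false, Finset.prod_const_one, mul_one]
    rcases Int.units_eq_one_or (Equiv.Perm.sign e) with h | h <;> simp [h]
  obtain ⟨σ, hσ⟩ : ∃ σ : Matrix.SpecialLinearGroup (Fin (m + 1)) ℝ,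
      (σ : Matrix (Fin (m + 1)) (Fin (m + 1)) ℝ) = Matrix.diagonal d * e.permMatrix ℝ :=
    ⟨⟨_, hdet⟩, rfl⟩
  refine ⟨σ, d 0, fun g => ?_, fun t => ?_⟩
  · ext j
    rw [Matrix.SpecialLinearGroup.coe_mul, hσ, Matrix.mul_assoc, Matrix.diagonal_mul,
      Equiv.Perm.permMatrix, PEquiv.toMatrix_toPEquiv_mul]
    simp [e]
  · apply Subtype.ext
    rw [Matrix.SpecialLinearGroup.coe_mul, Matrix.SpecialLinearGroup.coe_mul, torus_coe,
      torus_coe, hσ]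
    ext k l
    simp only [Matrix.diagonal_mul, Matrix.mul_diagonal, Equiv.Perm.permMatrix,
      PEquiv.toMatrix_apply, Finset.sum_pi_single', Finset.mem_univ, if_true]
    by_cases hl : e k = l
    · have : (Pi.single 0 t : Fin (m + 1) → ℝ) k = (Pi.single i t : Fin (m + 1) → ℝ) l := by
        subst hl
        simp only [Pi.single_apply, e]
        congr 1
        rw [eq_iff_iff, Equiv.swap_apply_eq_iff, Equiv.swap_apply_right]
      rw [this]
      ring
    · simp [hl]

end Torus

section Representation

variable {m : ℕ} {F : Type*} [NormedAddCommGroup F] [NormedSpace ℝ F]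

/-- The vectors whose orbit under `A t`, `t ≥ 0`, is bounded. -/
def boundedVectors (A : ℝ → Module.End ℝ F) : Submodule ℝ F where
  carrier := {x | ∃ K, ∀ t, 0 ≤ t → ‖A t x‖ ≤ K}
  zero_mem' := ⟨0, fun t _ => by simp⟩
  add_mem' := by
    rintro x y ⟨K, hK⟩ ⟨L, hL⟩
    refine ⟨K + L, fun t ht => ?_⟩
    rw [map_add]
    exact (norm_add_le _ _).trans (add_le_add (hK t ht) (hL t ht))
  smul_mem' := by
    rintro c x ⟨K, hK⟩
    refine ⟨‖c‖ * K, fun t ht => ?_⟩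
    rw [map_smul, norm_smul]
    exact mul_le_mul_of_nonneg_left (hK t ht) (norm_nonneg c)

lemma mem_boundedVectors {A : ℝ → Module.End ℝ F} {x : F} :
    x ∈ boundedVectors A ↔ ∃ K, ∀ t, 0 ≤ t → ‖A t x‖ ≤ K := Iff.rfl

lemma mem_wtSpace_iff {ρ : Matrix.SpecialLinearGroup (Fin (m + 1)) ℝ →* Module.End ℝ F}
    {μ : ℝ} {x : F} :
    x ∈ wtSpace m ρ μ ↔ ∀ t, ρ (aSL m t) x = Real.exp (μ * t) • x := by
  simp [wtSpace, Submodule.mem_iInf]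

lemma wtSpace_le_boundedVectors
    (ρ : Matrix.SpecialLinearGroup (Fin (m + 1)) ℝ →* Module.End ℝ F) {μ : ℝ} (hμ : μ ≤ 0) :
    wtSpace m ρ μ ≤ boundedVectors fun t => ρ (aSL m t) := by
  intro x hx
  rw [mem_wtSpace_iff] at hx
  refine ⟨‖x‖, fun t ht => ?_⟩
  rw [hx, norm_smul, Real.norm_of_nonneg (Real.exp_pos _).le]
  exact mul_le_of_le_one_left (norm_nonneg x)
    (Real.exp_le_one_iff.2 (mul_nonpos_of_nonpos_of_nonneg hμ ht))

lemma nonpos_weights_le_boundedVectors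
    (ρ : Matrix.SpecialLinearGroup (Fin (m + 1)) ℝ →* Module.End ℝ F) :
    wtSpace m ρ 0 ⊔ ⨆ μ ∈ Set.Iio (0 : ℝ), wtSpace m ρ μ ≤
      boundedVectors fun t => ρ (aSL m t) :=
  sup_le (wtSpace_le_boundedVectors ρ le_rfl)
    (iSup₂_le fun _ hμ => wtSpace_le_boundedVectors ρ (le_of_lt hμ))

/-- A finite sum of exponentials with vector coefficients that is bounded as `t → ∞` has no
growing terms. -/
lemma exp_sum_coeff_eq_zero (f : ℝ → F) (s : Finset ℝ) {K : ℝ}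
    (hK : ∀ t, 0 ≤ t → ‖∑ μ ∈ s, Real.exp (μ * t) • f μ‖ ≤ K) :
    ∀ μ ∈ s, 0 < μ → f μ = 0 := by
  induction s using Finset.induction_on_max with
  | empty => simp
  | insert c s hc ih =>
    have hcs : c ∉ s := fun h => lt_irrefl _ (hc c h)
    by_cases hc0 : 0 < c
    · have hfc : f c = 0 := by
        have h1 : Tendsto (fun t : ℝ => Real.exp (-c * t) •
            ∑ μ ∈ insert c s, Real.exp (μ * t) • f μ) atTop (𝓝 0) := by
          have hexp : Tendsto (fun t : ℝ => Real.exp (-c * t)) atTop (𝓝 0) :=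
            Real.tendsto_exp_atBot.comp
              (tendsto_id.const_mul_atTop_of_neg (neg_lt_zero.2 hc0))
          refine squeeze_zero_norm' ?_ (by simpa only [zero_mul] using hexp.mul_const K)
          filter_upwards [eventually_ge_atTop 0] with t ht
          rw [norm_smul, Real.norm_of_nonneg (Real.exp_pos _).le]
          exact mul_le_mul_of_nonneg_left (hK t ht) (Real.exp_pos _).le
        have h2 : Tendsto (fun t : ℝ => Real.exp (-c * t) •
            ∑ μ ∈ insert c s, Real.exp (μ * t) • f μ) atTop (𝓝 (f c + ∑ μ ∈ s, (0 : ℝ) • f μ)) := by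
          have : (fun t : ℝ => Real.exp (-c * t) • ∑ μ ∈ insert c s, Real.exp (μ * t) • f μ) =
              fun t : ℝ => f c + ∑ μ ∈ s, Real.exp ((μ - c) * t) • f μ := by
            funext t
            rw [Finset.sum_insert hcs, smul_add, smul_smul, ← Real.exp_add, Finset.smul_sum]
            congr 1
            · simp
            · refine Finset.sum_congr rfl fun μ _ => ?_
              rw [smul_smul, ← Real.exp_add]
              ring_nf
          rw [this]
          refine tendsto_const_nhds.add (tendsto_finsetSum _ fun μ hμ => ?_)
          exact (Real.tendsto_exp_atBot.comp
            (tendsto_id.const_mul_atTop_of_neg (sub_neg.2 (hc μ hμ)))).smul_const _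
        simpa using tendsto_nhds_unique h2 h1
      intro μ hμ hμ0
      rcases Finset.mem_insert.1 hμ with rfl | hμ
      · exact hfc
      · refine ih (fun t ht => ?_) μ hμ hμ0
        simpa [Finset.sum_insert hcs, hfc] using hK t ht
    · intro μ hμ hμ0
      rcases Finset.mem_insert.1 hμ with rfl | hμ
      · exact absurd hμ0 hc0
      · exact absurd (hμ0.trans (hc μ hμ)) hc0

/-- A vector with bounded orbit under the diagonalisable flow `a_t` is fixed by it. -/
lemma aSL_fixed_of_bounded
    (ρ : Matrix.SpecialLinearGroup (Fin (m + 1)) ℝ →* Module.End ℝ F)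
    (hss : (⨆ μ : ℝ, wtSpace m ρ μ) = ⊤) {x : F} {K : ℝ} (hK : ∀ t, ‖ρ (aSL m t) x‖ ≤ K)
    (t : ℝ) : ρ (aSL m t) x = x := by
  obtain ⟨f, hf, rfl⟩ := (Submodule.mem_iSup_iff_exists_finsupp _ _).1
    (hss ▸ Submodule.mem_top : x ∈ ⨆ μ : ℝ, wtSpace m ρ μ)
  have hsum : ∀ t, ρ (aSL m t) (f.sum fun _ y => y) =
      ∑ μ ∈ f.support, Real.exp (μ * t) • f μ := by
    intro t
    rw [Finsupp.sum, map_sum]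
    exact Finset.sum_congr rfl fun μ _ => mem_wtSpace_iff.1 (hf μ) t
  have hpos : ∀ μ ∈ f.support, 0 < μ → f μ = 0 :=
    exp_sum_coeff_eq_zero f f.support fun t _ => by rw [← hsum]; exact hK t
  have hneg : ∀ μ ∈ f.support.map (Equiv.neg ℝ).toEmbedding, 0 < μ → f (-μ) = 0 :=
    exp_sum_coeff_eq_zero (fun μ => f (-μ)) _ (K := K) fun t _ => by
      have := hK (-t)
      rw [hsum] at this
      simpa using this
  rw [hsum, Finsupp.sum]
  refine Finset.sum_congr rfl fun μ hμ => ?_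
  rcases lt_trichotomy μ 0 with h | rfl | h
  · have := hneg (-μ) (by simpa using hμ) (neg_pos.2 h)
    rw [neg_neg] at this
    simp [this]
  · simp
  · simp [hpos μ hμ h]

lemma torus_single_fixed_of_bounded
    (ρ : Matrix.SpecialLinearGroup (Fin (m + 1)) ℝ →* Module.End ℝ F)
    (hss : (⨆ μ : ℝ, wtSpace m ρ μ) = ⊤) (i : Fin (m + 1)) {x : F} {K : ℝ}
    (hK : ∀ t, ‖ρ (torus (Pi.single i t)) x‖ ≤ K)
    (hbdd : ∀ g, ∃ L, ∀ y : F, ‖ρ g y‖ ≤ L * ‖y‖) (t : ℝ) :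
    ρ (torus (Pi.single i t)) x = x := by
  obtain ⟨σ, -, -, hσ⟩ := exists_weyl (m := m) i
  obtain ⟨L, hL⟩ := hbdd σ
  have hm : (m + 1 : ℝ) ≠ 0 := by positivity
  have hfix : ∀ t, ρ (torus (Pi.single 0 t)) (ρ σ x) = ρ σ x := by
    intro t
    have := aSL_fixed_of_bounded ρ hss (x := ρ σ x) (K := |L| * K) (fun t => ?_) (t / (m + 1))
    · rwa [aSL_eq_torus, mul_div_cancel₀ _ hm] at this
    · rw [aSL_eq_torus, ← Module.End.mul_apply, ← map_mul, hσ, map_mul, Module.End.mul_apply]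
      refine (hL _).trans ((mul_le_mul_of_nonneg_right (le_abs_self L) (norm_nonneg _)).trans ?_)
      exact mul_le_mul_of_nonneg_left (hK _) (abs_nonneg L)
  have h := hfix t
  rw [← Module.End.mul_apply, ← map_mul, hσ, map_mul, Module.End.mul_apply] at h
  have h' := congrArg (ρ σ⁻¹) h
  rwa [← Module.End.mul_apply, ← map_mul, inv_mul_cancel, map_one, Module.End.one_apply,
    ← Module.End.mul_apply, ← map_mul, inv_mul_cancel, map_one, Module.End.one_apply] at h'

variable [FiniteDimensional ℝ F]

/-- Uniform boundedness for a family of linear maps on a subspace of a finite-dimensional space. -/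
lemma exists_uniform_bound {ι : Type*} (A : ι → Module.End ℝ F) (S : Submodule ℝ F)
    (h : ∀ x ∈ S, ∃ K, ∀ i, ‖A i x‖ ≤ K) : ∃ K, 0 ≤ K ∧ ∀ i, ∀ x ∈ S, ‖A i x‖ ≤ K * ‖x‖ := by
  have := FiniteDimensional.complete ℝ S
  obtain ⟨K, hK⟩ := banach_steinhaus
    (g := fun i => LinearMap.toContinuousLinearMap ((A i).comp S.subtype))
    fun x => by simpa using h x x.2
  refine ⟨max K 0, le_max_right _ _, fun i x hx => ?_⟩
  have := (LinearMap.toContinuousLinearMap ((A i).comp S.subtype)).le_opNorm ⟨x, hx⟩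
  simp only [LinearMap.coe_toContinuousLinearMap', LinearMap.comp_apply, Submodule.subtype_apply,
    Submodule.coe_norm] at this
  exact this.trans (mul_le_mul_of_nonneg_right ((hK i).trans (le_max_left _ _)) (norm_nonneg x))

lemma exists_norm_map_le (A : Module.End ℝ F) : ∃ L, ∀ y : F, ‖A y‖ ≤ L * ‖y‖ :=
  ⟨_, (LinearMap.toContinuousLinearMap A).le_opNorm⟩

/-- Elements of `SL` with bounded entries act in a uniformly bounded way. -/
lemma exists_bound_of_entries_le
    (ρ : Matrix.SpecialLinearGroup (Fin (m + 1)) ℝ →* Module.End ℝ F)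
    (hcont : ∀ v : F, Continuous fun g => ρ g v) (C : ℝ) :
    ∃ K, ∀ g : Matrix.SpecialLinearGroup (Fin (m + 1)) ℝ, (∀ i j, |g i j| ≤ C) →
      ∀ x, ‖ρ g x‖ ≤ K * ‖x‖ := by
  set T : Set (Matrix.SpecialLinearGroup (Fin (m + 1)) ℝ) := {g | ∀ i j, |g i j| ≤ C}
  have hT : IsCompact T := by
    have hemb : IsClosedEmbedding
        (fun g : Matrix.SpecialLinearGroup (Fin (m + 1)) ℝ =>
          (g : Matrix (Fin (m + 1)) (Fin (m + 1)) ℝ)) := by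
      refine ⟨⟨⟨rfl⟩, Subtype.val_injective⟩, ?_⟩
      have : Set.range (fun g : Matrix.SpecialLinearGroup (Fin (m + 1)) ℝ =>
          (g : Matrix (Fin (m + 1)) (Fin (m + 1)) ℝ)) = {M | M.det = 1} := Subtype.range_coe
      rw [this]
      exact isClosed_eq (continuous_id.matrix_det) continuous_const
    have hK : IsCompact (Set.pi Set.univ fun _ : Fin (m + 1) =>
        Set.pi Set.univ fun _ : Fin (m + 1) => Set.Icc (-C) C) :=
      isCompact_univ_pi fun _ => isCompact_univ_pi fun _ => isCompact_Icc
    convert hemb.isCompact_preimage hK using 1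
    ext g
    exact ⟨fun h i _ j _ => abs_le.1 (h i j), fun h i j => abs_le.2 (h i trivial j trivial)⟩
  obtain ⟨K, -, hK⟩ := exists_uniform_bound (fun g : T => ρ g) ⊤ fun x _ => by
    obtain ⟨L, hL⟩ := hT.exists_bound_of_continuousOn (hcont x).continuousOn
    exact ⟨L, fun g => hL g g.2⟩
  exact ⟨K, fun g hg x => hK ⟨g, hg⟩ x trivial⟩

end Representation

section Fixed

variable {m : ℕ} {F : Type*} [NormedAddCommGroup F] [NormedSpace ℝ F]

lemma torus_mul_comm (w w' : Fin (m + 1) → ℝ) : torus w * torus w' = torus w' * torus w := by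
  rw [← torus_add, ← torus_add, add_comm w w']

lemma torus_single_neg (i : Fin (m + 1)) (t : ℝ) :
    torus (Pi.single i (-t)) = torus (∑ j ∈ Finset.univ.erase i, Pi.single j t) := by
  refine torus_congr (-t) fun j => ?_
  have h : (∑ k ∈ Finset.univ.erase i, (Pi.single k t : Fin (m + 1) → ℝ)) j =
      if j = i then 0 else t := by
    rw [Finset.sum_apply]
    simp [Pi.single_apply]
  rw [h, Pi.single_apply]
  split_ifs <;> ring

/-- Vectors whose orbits are bounded along every positive coordinate ray of the torus. -/
def torusBounded (ρ : Matrix.SpecialLinearGroup (Fin (m + 1)) ℝ →* Module.End ℝ F) :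
    Submodule ℝ F :=
  ⨅ i, boundedVectors fun t => ρ (torus (Pi.single i t))

lemma mem_torusBounded {ρ : Matrix.SpecialLinearGroup (Fin (m + 1)) ℝ →* Module.End ℝ F} {x : F} :
    x ∈ torusBounded ρ ↔ ∀ i, ∃ K, ∀ t, 0 ≤ t → ‖ρ (torus (Pi.single i t)) x‖ ≤ K := by
  simp [torusBounded, Submodule.mem_iInf, mem_boundedVectors]

variable [FiniteDimensional ℝ F]

lemma torus_smul_mem_torusBounded
    {ρ : Matrix.SpecialLinearGroup (Fin (m + 1)) ℝ →* Module.End ℝ F} {x : F}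
    (hx : x ∈ torusBounded ρ) (w : Fin (m + 1) → ℝ) : ρ (torus w) x ∈ torusBounded ρ := by
  rw [mem_torusBounded] at hx ⊢
  intro i
  obtain ⟨K, hK⟩ := hx i
  obtain ⟨L, hL⟩ := exists_norm_map_le (ρ (torus w))
  refine ⟨|L| * K, fun t ht => ?_⟩
  rw [← Module.End.mul_apply, ← map_mul, torus_mul_comm, map_mul, Module.End.mul_apply]
  refine (hL _).trans ((mul_le_mul_of_nonneg_right (le_abs_self L) (norm_nonneg _)).trans ?_)
  exact mul_le_mul_of_nonneg_left (hK t ht) (abs_nonneg L)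

lemma exists_bound_torus_sum
    (ρ : Matrix.SpecialLinearGroup (Fin (m + 1)) ℝ →* Module.End ℝ F)
    (s : Finset (Fin (m + 1))) :
    ∃ K, 0 ≤ K ∧ ∀ t, 0 ≤ t → ∀ y ∈ torusBounded ρ,
      ‖ρ (torus (∑ i ∈ s, Pi.single i t)) y‖ ≤ K * ‖y‖ := by
  induction s using Finset.induction_on with
  | empty => exact ⟨1, zero_le_one, fun t _ y _ => by simp [torus_zero]⟩
  | insert i s hi ih =>
    obtain ⟨K, hK0, hK⟩ := ih
    obtain ⟨L, hL0, hL⟩ := exists_uniform_bound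
      (fun t : Set.Ici (0 : ℝ) => ρ (torus (Pi.single i (t : ℝ)))) (torusBounded ρ) fun x hx => by
        obtain ⟨K, hK⟩ := mem_torusBounded.1 hx i
        exact ⟨K, fun t => hK t t.2⟩
    refine ⟨L * K, mul_nonneg hL0 hK0, fun t ht y hy => ?_⟩
    rw [Finset.sum_insert hi, torus_add, map_mul, Module.End.mul_apply, mul_assoc]
    exact (hL ⟨t, ht⟩ _ (torus_smul_mem_torusBounded hy _)).trans
      (mul_le_mul_of_nonneg_left (hK t ht y hy) hL0)

/-- Since the coordinate tori multiply to the identity, boundedness along all the positive rays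
implies invariance. -/
lemma torus_single_fixed_of_mem_torusBounded
    {ρ : Matrix.SpecialLinearGroup (Fin (m + 1)) ℝ →* Module.End ℝ F}
    (hss : (⨆ μ : ℝ, wtSpace m ρ μ) = ⊤) {x : F} (hx : x ∈ torusBounded ρ) (i : Fin (m + 1))
    (t : ℝ) : ρ (torus (Pi.single i t)) x = x := by
  obtain ⟨K, hK⟩ := mem_torusBounded.1 hx i
  obtain ⟨L, -, hL⟩ := exists_bound_torus_sum ρ (Finset.univ.erase i)
  refine torus_single_fixed_of_bounded ρ hss i (K := max K (L * ‖x‖)) (fun t => ?_)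
    (fun g => exists_norm_map_le (ρ g)) t
  rcases le_total 0 t with ht | ht
  · exact (hK t ht).trans (le_max_left _ _)
  · have := hL (-t) (neg_nonneg.2 ht) x hx
    rw [← torus_single_neg, neg_neg] at this
    exact this.trans (le_max_right _ _)

lemma coe_mul_row (g h : Matrix.SpecialLinearGroup (Fin (m + 1)) ℝ) (i : Fin (m + 1)) :
    (g * h) i = g i ᵥ* (h : Matrix (Fin (m + 1)) (Fin (m + 1)) ℝ) := by
  rw [Matrix.SpecialLinearGroup.coe_mul]
  exact Matrix.mul_apply_eq_vecMul _ _ _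

lemma uSL_row_zero (ξ : Fin m → ℝ) : uSL m ξ 0 = Fin.cons 1 ξ := by
  ext j
  refine Fin.cases ?_ (fun j => ?_) j <;>
    simp [uSL, uMat, Xmat, (Fin.succ_ne_zero _).symm]

/-- Boundedness under `a_t` of the vector `ρ q v` depends only on the line spanned by the first row
of `q`. -/
lemma mem_boundedVectors_of_row
    {ρ : Matrix.SpecialLinearGroup (Fin (m + 1)) ℝ →* Module.End ℝ F}
    (hcont : ∀ v : F, Continuous fun g => ρ g v) {v : F} {ξ : Fin m → ℝ}
    (hξ : ρ (uSL m ξ) v ∈ boundedVectors fun t => ρ (aSL m t))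
    {q : Matrix.SpecialLinearGroup (Fin (m + 1)) ℝ} {c : ℝ}
    (hq : q 0 = c • (Fin.cons 1 ξ : Fin (m + 1) → ℝ)) :
    ρ q v ∈ boundedVectors fun t => ρ (aSL m t) := by
  set p := q * (uSL m ξ)⁻¹ with hp
  have hp0 : p 0 = c • Pi.single 0 1 := by
    have h1 : uSL m ξ 0 = (1 : Matrix.SpecialLinearGroup (Fin (m + 1)) ℝ) 0 ᵥ*
        (uSL m ξ : Matrix (Fin (m + 1)) (Fin (m + 1)) ℝ) := by
      rw [← coe_mul_row, one_mul]
    rw [hp, coe_mul_row, hq, ← uSL_row_zero, Matrix.smul_vecMul, ← coe_mul_row, mul_inv_cancel]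
    congr 1
    ext j
    simp [Matrix.one_apply, Pi.single_apply, eq_comm]
  obtain ⟨K, hK⟩ := exists_bound_of_entries_le ρ hcont (∑ i, ∑ j, |p i j|)
  obtain ⟨L, hL⟩ := hξ
  refine ⟨|K| * L, fun t ht => ?_⟩
  have hfac : aSL m t * q = (aSL m t * p * (aSL m t)⁻¹) * (aSL m t * uSL m ξ) := by
    rw [hp]; group
  change ‖ρ (aSL m t) (ρ q v)‖ ≤ _
  rw [← Module.End.mul_apply, ← map_mul, hfac, map_mul, map_mul ρ (aSL m t), Module.End.mul_apply,
    Module.End.mul_apply]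
  refine (hK _ (fun i j => ?_) _).trans
    ((mul_le_mul_of_nonneg_right (le_abs_self K) (norm_nonneg _)).trans
      (mul_le_mul_of_nonneg_left (hL t ht) (abs_nonneg K)))
  have hle : |p i j| ≤ ∑ i, ∑ j, |p i j| :=
    (Finset.single_le_sum (f := fun j => |p i j|) (fun _ _ => abs_nonneg _)
      (Finset.mem_univ j)).trans
      (Finset.single_le_sum (f := fun i => ∑ j, |p i j|)
        (fun _ _ => Finset.sum_nonneg fun _ _ => abs_nonneg _) (Finset.mem_univ i))
  rw [aSL_eq_torus, torus_conj_apply, abs_mul, Real.abs_exp]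
  have hmt : 0 ≤ (m + 1 : ℝ) * t := by positivity
  by_cases hz : i = 0 ∧ j ≠ 0
  · have : p i j = 0 := by
      rw [hz.1, hp0]
      simp [hz.2]
    rw [this] at hle ⊢
    simpa using hle
  · refine (mul_le_of_le_one_left (abs_nonneg _) (Real.exp_le_one_iff.2 ?_)).trans hle
    rw [Pi.single_apply, Pi.single_apply]
    split_ifs with h1 h2 h2
    · simp
    · exact absurd ⟨h1, h2⟩ hz
    · linarith
    · simp

/-- If every row of `h` is proportional to some `(1, ξ)` with `ρ (u ξ) v` of nonpositive weight,
then `ρ h v` is fixed by the torus. -/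
lemma torus_single_fixed_of_rows
    {ρ : Matrix.SpecialLinearGroup (Fin (m + 1)) ℝ →* Module.End ℝ F}
    (hcont : ∀ v : F, Continuous fun g => ρ g v)
    (hss : (⨆ μ : ℝ, wtSpace m ρ μ) = ⊤) {v : F}
    {h : Matrix.SpecialLinearGroup (Fin (m + 1)) ℝ}
    (hrow : ∀ i, ∃ (c : ℝ) (ξ : Fin m → ℝ), h i = c • (Fin.cons 1 ξ : Fin (m + 1) → ℝ) ∧
      ρ (uSL m ξ) v ∈ boundedVectors fun t => ρ (aSL m t)) (i : Fin (m + 1)) (t : ℝ) :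
    ρ (torus (Pi.single i t)) (ρ h v) = ρ h v := by
  refine torus_single_fixed_of_mem_torusBounded hss (mem_torusBounded.2 fun i => ?_) i t
  obtain ⟨σ, d, hσ0, hσ⟩ := exists_weyl (m := m) i
  obtain ⟨c, ξ, hc, hξ⟩ := hrow i
  obtain ⟨K, hK⟩ := mem_boundedVectors_of_row hcont hξ (q := σ * h) (c := d * c)
    (by rw [hσ0, hc, smul_smul])
  obtain ⟨L, hL⟩ := exists_norm_map_le (ρ σ⁻¹)
  refine ⟨|L| * K, fun t ht => ?_⟩
  have hm : (0 : ℝ) < m + 1 := by positivity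
  have hfac : torus (Pi.single i t) * h = σ⁻¹ * (aSL m (t / (m + 1)) * (σ * h)) := by
    rw [aSL_eq_torus, mul_div_cancel₀ _ hm.ne', ← mul_assoc (torus _), hσ]
    group
  rw [← Module.End.mul_apply, ← map_mul, hfac, map_mul, Module.End.mul_apply]
  refine (hL _).trans ((mul_le_mul_of_nonneg_right (le_abs_self L) (norm_nonneg _)).trans ?_)
  refine mul_le_mul_of_nonneg_left ?_ (abs_nonneg L)
  rw [map_mul, Module.End.mul_apply]
  exact hK _ (div_nonneg ht hm.le)

end Fixed

section Generation

variable {m : ℕ}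

/-- The unipotent matrix obtained from `1` by adding the row vector `s` to the `i`-th row. -/
def rowShear (i : Fin (m + 1)) (s : Fin (m + 1) → ℝ) (hs : s i = 0) :
    Matrix.SpecialLinearGroup (Fin (m + 1)) ℝ :=
  ⟨1 + Matrix.vecMulVec (Pi.single i 1) s, by
    rw [Matrix.vecMulVec_eq Unit, Matrix.det_one_add_replicateCol_mul_replicateRow]
    simp [hs]⟩

lemma rowShear_coe (i : Fin (m + 1)) (s : Fin (m + 1) → ℝ) (hs : s i = 0) :
    (rowShear i s hs : Matrix (Fin (m + 1)) (Fin (m + 1)) ℝ) =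
      1 + Matrix.vecMulVec (Pi.single i 1) s := rfl

lemma rowShear_apply (i : Fin (m + 1)) (s : Fin (m + 1) → ℝ) (hs : s i = 0) (k l : Fin (m + 1)) :
    rowShear i s hs k l = (1 : Matrix (Fin (m + 1)) (Fin (m + 1)) ℝ) k l +
      if k = i then s l else 0 := by
  rw [rowShear_coe, Matrix.add_apply, Matrix.vecMulVec_apply, Pi.single_apply, ite_mul, one_mul,
    zero_mul]

lemma rowShear_mul (i : Fin (m + 1)) (s s' : Fin (m + 1) → ℝ) (hs : s i = 0) (hs' : s' i = 0) :
    rowShear i s hs * rowShear i s' hs' = rowShear i (s + s') (by simp [hs, hs']) := by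
  apply Subtype.ext
  rw [Matrix.SpecialLinearGroup.coe_mul, rowShear_coe, rowShear_coe, rowShear_coe, add_mul, mul_add,
    mul_add, Matrix.vecMulVec_mul_vecMulVec, Matrix.vecMulVec_add]
  simp [hs]
  abel

lemma torus_conj_rowShear (w : Fin (m + 1) → ℝ) (i : Fin (m + 1)) (s : Fin (m + 1) → ℝ)
    (hs : s i = 0) : torus w * rowShear i s hs * (torus w)⁻¹ =
      rowShear i (fun l => Real.exp (w i - w l) * s l) (by simp [hs]) := by
  ext k l
  rw [torus_conj_apply, rowShear_apply, rowShear_apply, mul_add]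
  congr 1
  · rw [Matrix.one_apply]
    split_ifs with h <;> simp [h]
  · split_ifs with h <;> simp [h]

lemma transvection_eq_rowShear {i j : Fin (m + 1)} (hij : i ≠ j) (y : ℝ) :
    Matrix.SpecialLinearGroup.transvection hij y = rowShear i (Pi.single j y) (by simp [hij]) := by
  ext k l
  rw [rowShear_apply, Matrix.SpecialLinearGroup.transvection_coe,
    Matrix.add_apply, Matrix.single_apply, Pi.single_apply]
  grind

lemma transvection_mul_transvection {i j k : Fin (m + 1)} (hij : i ≠ j) (hjk : j ≠ k) (hik : i ≠ k)
    (a b : ℝ) : Matrix.SpecialLinearGroup.transvection hij a *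
      Matrix.SpecialLinearGroup.transvection hjk b =
      Matrix.SpecialLinearGroup.transvection hik (a * b) *
        (Matrix.SpecialLinearGroup.transvection hjk b *
          Matrix.SpecialLinearGroup.transvection hij a) := by
  apply Subtype.ext
  simp only [Matrix.SpecialLinearGroup.coe_mul, Matrix.SpecialLinearGroup.transvection_coe,
    mul_add, add_mul, mul_one, one_mul, Matrix.single_mul_single_same,
    Matrix.single_mul_single_of_ne, hjk.symm, hik.symm, ne_eq, not_false_eq_true,
    add_zero]
  abel

lemma transvection_weyl_coe {i j : Fin (m + 1)} (hij : i ≠ j) {a : ℝ} (ha : a ≠ 0) :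
    ((Matrix.SpecialLinearGroup.transvection hij a *
      Matrix.SpecialLinearGroup.transvection hij.symm (-a⁻¹) *
      Matrix.SpecialLinearGroup.transvection hij a :
        Matrix.SpecialLinearGroup (Fin (m + 1)) ℝ) : Matrix (Fin (m + 1)) (Fin (m + 1)) ℝ) =
      1 - Matrix.single i i 1 - Matrix.single j j 1 + Matrix.single i j a -
        Matrix.single j i a⁻¹ := by
  simp only [Matrix.SpecialLinearGroup.coe_mul, Matrix.SpecialLinearGroup.transvection_coe,
    mul_add, add_mul, mul_one, one_mul, Matrix.single_mul_single_same,
    Matrix.single_mul_single_of_ne, hij.symm, ne_eq, not_false_eq_true, add_zero, mul_neg, neg_mul,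
    mul_inv_cancel₀ ha, inv_mul_cancel₀ ha, ← Matrix.single_neg]
  abel

lemma diag2n_eq {i j : Fin (m + 1)} (hij : i ≠ j) {a : ℝ} (ha : a ≠ 0) :
    Matrix.SpecialLinearGroup.diag2n hij a ha =
      (Matrix.SpecialLinearGroup.transvection hij a *
        Matrix.SpecialLinearGroup.transvection hij.symm (-a⁻¹) *
        Matrix.SpecialLinearGroup.transvection hij a) *
      (Matrix.SpecialLinearGroup.transvection hij (-1) *
        Matrix.SpecialLinearGroup.transvection hij.symm (-(-1)⁻¹) *
        Matrix.SpecialLinearGroup.transvection hij (-1)) := by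
  apply Subtype.ext
  rw [Matrix.SpecialLinearGroup.coe_mul, transvection_weyl_coe hij ha,
    transvection_weyl_coe hij (neg_ne_zero.2 one_ne_zero), Matrix.SpecialLinearGroup.diag2n_coe]
  simp only [mul_add, add_mul, mul_sub, sub_mul, mul_one, one_mul, Matrix.single_mul_single_same,
    Matrix.single_mul_single_of_ne, hij, hij.symm, ne_eq,
    not_false_eq_true, add_zero, sub_zero]
  ext k l
  simp only [Matrix.diagonal_apply, Matrix.add_apply, Matrix.sub_apply,
    Matrix.single_apply, Matrix.one_apply]
  grind

lemma eq_top_of_transvection_mem (hm : 1 ≤ m)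
    (Γ : Subgroup (Matrix.SpecialLinearGroup (Fin (m + 1)) ℝ))
    (h : ∀ (i j : Fin (m + 1)) (hij : i ≠ j) (y : ℝ),
      Matrix.SpecialLinearGroup.transvection hij y ∈ Γ) : Γ = ⊤ := by
  have : Nontrivial (Fin (m + 1)) := Fin.nontrivial_iff_two_le.2 (by omega)
  refine (Subgroup.eq_top_iff' Γ).2 fun g => ?_
  refine Matrix.SpecialLinearGroup.diagonal_transvection_induction' (· ∈ Γ) g
    (fun i j hij c hc => ?_) h fun A B => Γ.mul_mem
  rw [diag2n_eq]
  exact Γ.mul_mem (Γ.mul_mem (Γ.mul_mem (h _ _ _ _) (h _ _ _ _)) (h _ _ _ _))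
    (Γ.mul_mem (Γ.mul_mem (h _ _ _ _) (h _ _ _ _)) (h _ _ _ _))

/-- Two indices are linked when `Γ` contains both of the corresponding root subgroups. -/
def linked (Γ : Subgroup (Matrix.SpecialLinearGroup (Fin (m + 1)) ℝ)) (i j : Fin (m + 1)) : Prop :=
  ∀ hij : i ≠ j, ∀ y, Matrix.SpecialLinearGroup.transvection hij y ∈ Γ ∧
    Matrix.SpecialLinearGroup.transvection hij.symm y ∈ Γ

variable {Γ : Subgroup (Matrix.SpecialLinearGroup (Fin (m + 1)) ℝ)}

lemma linked.symm {i j : Fin (m + 1)} (h : linked Γ i j) : linked Γ j i :=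
  fun hij y => (h hij.symm y).symm

lemma transvection_mem_of_mem {i j k : Fin (m + 1)} (hij : i ≠ j) (hjk : j ≠ k) (hik : i ≠ k)
    (h₁ : ∀ y, Matrix.SpecialLinearGroup.transvection hij y ∈ Γ)
    (h₂ : ∀ y, Matrix.SpecialLinearGroup.transvection hjk y ∈ Γ) (y : ℝ) :
    Matrix.SpecialLinearGroup.transvection hik y ∈ Γ := by
  have h := transvection_mul_transvection hij hjk hik y 1
  rw [mul_one, ← mul_inv_eq_iff_eq_mul] at h
  rw [← h]
  exact Γ.mul_mem (Γ.mul_mem (h₁ _) (h₂ _)) (Γ.inv_mem (Γ.mul_mem (h₂ _) (h₁ _)))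

lemma linked.trans {i j k : Fin (m + 1)} (h₁ : linked Γ i j) (h₂ : linked Γ j k) :
    linked Γ i k := by
  by_cases hij : i = j
  · exact hij ▸ h₂
  by_cases hjk : j = k
  · exact hjk ▸ h₁
  exact fun hik y => ⟨transvection_mem_of_mem hij hjk hik (fun y => (h₁ hij y).1)
    (fun y => (h₂ hjk y).1) y, transvection_mem_of_mem (Ne.symm hjk) (Ne.symm hij) hik.symm
    (fun y => (h₂ hjk y).2) (fun y => (h₁ hij y).2) y⟩

/-- If `Γ` contains the torus and one nontrivial element of a root subgroup, it contains the whole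
root subgroup. -/
lemma transvection_mem_of_torus (hT : ∀ i t, torus (Pi.single i t) ∈ Γ) {i j : Fin (m + 1)}
    (hij : i ≠ j) {y₀ : ℝ} (hy₀ : y₀ ≠ 0)
    (h : Matrix.SpecialLinearGroup.transvection hij y₀ ∈ Γ) (y : ℝ) :
    Matrix.SpecialLinearGroup.transvection hij y ∈ Γ := by
  have hpos : ∀ c : ℝ, 0 < c → Matrix.SpecialLinearGroup.transvection hij (c * y₀) ∈ Γ := by
    intro c hc
    have hmem := Γ.mul_mem (Γ.mul_mem (hT i (Real.log c)) h) (Γ.inv_mem (hT i (Real.log c)))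
    rw [transvection_eq_rowShear, torus_conj_rowShear] at hmem
    rw [transvection_eq_rowShear]
    convert hmem using 2
    ext l
    by_cases hl : l = j
    · subst hl
      simp [hij.symm, Real.exp_log hc]
    · simp [hl]
  rcases lt_trichotomy (y / y₀) 0 with hc | hc | hc
  · have hmem := Γ.inv_mem (hpos _ (neg_pos.2 hc))
    rw [Matrix.SpecialLinearGroup.transvection_inv] at hmem
    convert hmem using 2
    field_simp
  · rw [(div_eq_zero_iff.1 hc).resolve_right hy₀,
      Matrix.SpecialLinearGroup.transvection_coeff_zero]
    exact Γ.one_mem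
  · have hmem := hpos _ hc
    rwa [div_mul_cancel₀ _ hy₀] at hmem

/-- If a conjugate of the torus by a row shear lies in `Γ` together with the torus, then so do
the root subgroups in the support of the shear. -/
lemma transvection_mem_of_rowShear_conj (hT : ∀ i t, torus (Pi.single i t) ∈ Γ)
    {i j : Fin (m + 1)} (hij : i ≠ j) {s : Fin (m + 1) → ℝ} (hs : s i = 0) (hj : s j ≠ 0)
    (h : ∀ t, (rowShear i s hs)⁻¹ * torus (Pi.single i t) * rowShear i s hs ∈ Γ) (y : ℝ) :
    Matrix.SpecialLinearGroup.transvection hij y ∈ Γ := by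
  set E := rowShear i s hs with hE
  have hEΓ : E ∈ Γ := by
    have hconj : torus (Pi.single i (Real.log 2)) * E * (torus (Pi.single i (Real.log 2)))⁻¹ =
        E * E := by
      rw [hE, torus_conj_rowShear, rowShear_mul]
      congr 1
      ext l
      by_cases hl : l = i
      · simp [hl, hs]
      · simp [hl, Real.exp_log, two_mul]
    have hmem := Γ.mul_mem (h (Real.log 2)) (Γ.inv_mem (hT i (Real.log 2)))
    rwa [mul_assoc _ _ E, mul_assoc, hconj, inv_mul_cancel_left] at hmem
  refine transvection_mem_of_torus hT hij (y₀ := -(s j / 2)) (by simpa using hj) ?_ y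
  have hconj : torus (Pi.single j (Real.log 2)) * E * (torus (Pi.single j (Real.log 2)))⁻¹ =
      E * Matrix.SpecialLinearGroup.transvection hij (-(s j / 2)) := by
    rw [hE, torus_conj_rowShear, transvection_eq_rowShear, rowShear_mul]
    congr 1
    ext l
    by_cases hl : l = j
    · subst hl
      simp only [Pi.single_apply, hij, if_false, if_true, zero_sub, Real.exp_neg, Pi.add_apply,
        Real.exp_log (zero_lt_two' ℝ)]
      ring
    · simp [hl, hij]
  have hmem := Γ.mul_mem (Γ.mul_mem (hT j (Real.log 2)) hEΓ) (Γ.inv_mem (hT j (Real.log 2)))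
  rw [hconj] at hmem
  exact (Γ.mul_mem_cancel_left hEΓ).1 hmem

/-- A subgroup of `SL` containing the conjugates of the torus by all frames drawn from the cone over
a connected set avoiding the origin and containing the coordinate lines is the whole group. -/
lemma eq_top_of_isPreconnected (hm : 1 ≤ m) {A : Set (Fin (m + 1) → ℝ)} (hA : IsPreconnected A)
    (hA0 : 0 ∉ A) (hbasis : ∀ i, ∃ c : ℝ, ∃ x ∈ A, Pi.single i 1 = c • x)
    (hΓ : ∀ h : Matrix.SpecialLinearGroup (Fin (m + 1)) ℝ,
      (∀ i, ∃ c : ℝ, ∃ x ∈ A, h i = c • x) → ∀ i t, h⁻¹ * torus (Pi.single i t) * h ∈ Γ) :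
    Γ = ⊤ := by
  have hone : ∀ i, (1 : Matrix.SpecialLinearGroup (Fin (m + 1)) ℝ) i = Pi.single i 1 := by
    intro i
    ext j
    simp [Matrix.one_apply, Pi.single_apply, eq_comm]
  have hT : ∀ i t, torus (Pi.single i t) ∈ Γ := fun i t => by
    simpa using hΓ 1 (fun i => by rw [hone]; exact hbasis i) i t
  have hmem : ∀ x ∈ A, ∀ i j (hij : i ≠ j), x i ≠ 0 → x j ≠ 0 → ∀ y,
      Matrix.SpecialLinearGroup.transvection hij y ∈ Γ := by
    intro x hx i j hij hi hj
    have hs : ((x i)⁻¹ • x - Pi.single i 1 : Fin (m + 1) → ℝ) i = 0 := by simp [hi]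
    refine transvection_mem_of_rowShear_conj hT hij hs (by simp [hij.symm, hi, hj])
      (hΓ _ (fun k => ?_) i)
    by_cases hk : k = i
    · refine ⟨(x i)⁻¹, x, hx, ?_⟩
      ext l
      rw [rowShear_apply]
      simp [hk, Matrix.one_apply, Pi.single_apply, eq_comm]
    · have hrow : rowShear i _ hs k = Pi.single k 1 := by
        ext l
        rw [rowShear_apply]
        simp [hk, Matrix.one_apply, Pi.single_apply, eq_comm]
      rw [hrow]
      exact hbasis k
  have hlink : ∀ x ∈ A, ∀ i j, x i ≠ 0 → x j ≠ 0 → linked Γ i j := fun x hx i j hi hj hij y =>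
    ⟨hmem x hx i j hij hi hj y, hmem x hx j i hij.symm hj hi y⟩
  have hall : ∀ j, linked Γ 0 j := by
    by_contra! hne
    obtain ⟨j, hj⟩ := hne
    have hopen : ∀ P : Fin (m + 1) → Prop, IsOpen {x : Fin (m + 1) → ℝ | ∃ i, P i ∧ x i ≠ 0} := by
      intro P
      simp only [Set.ofPred_exists, Set.ofPred_and]
      exact isOpen_iUnion fun i => isOpen_const.inter
        (isOpen_ne_fun (continuous_apply i) continuous_const)
    have hne : ∀ (P : Fin (m + 1) → Prop) i, P i →
        (A ∩ {x : Fin (m + 1) → ℝ | ∃ i, P i ∧ x i ≠ 0}).Nonempty := by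
      intro P i hi
      obtain ⟨c, x, hx, hcx⟩ := hbasis i
      refine ⟨x, hx, i, hi, fun h0 => ?_⟩
      have := congrFun hcx i
      simp [h0] at this
    obtain ⟨x, hx, ⟨i, hi, hxi⟩, k, hk, hxk⟩ := hA _ _ (hopen fun i => linked Γ 0 i)
      (hopen fun i => ¬ linked Γ 0 i) (fun x hx => by
        have : x ≠ 0 := fun h => hA0 (h ▸ hx)
        obtain ⟨i, hi⟩ := Function.ne_iff.1 this
        by_cases hl : linked Γ 0 i
        · exact Or.inl ⟨i, hl, hi⟩
        · exact Or.inr ⟨i, hl, hi⟩)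
      (hne _ 0 fun h => absurd rfl h) (hne _ j hj)
    exact hk (hi.trans (hlink x hx i k hxi hxk))
  exact eq_top_of_transvection_mem hm Γ fun i j hij y =>
    ((hall i).symm.trans (hall j) hij y).1

end Generation

section Curve

variable {m : ℕ}

/-- A spanning set contains, up to scaling, the rows of a matrix of determinant one. -/
lemma exists_rows_of_span_eq_top {R : Set (Fin (m + 1) → ℝ)} (hR : Submodule.span ℝ R = ⊤) :
    ∃ g : Matrix.SpecialLinearGroup (Fin (m + 1)) ℝ, ∀ i, ∃ c : ℝ, ∃ x ∈ R, g i = c • x := by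
  obtain ⟨f, hfR, -, hf⟩ := Submodule.exists_fun_fin_finrank_span_eq ℝ R
  have hcard : m + 1 = Module.finrank ℝ (Submodule.span ℝ R) := by
    rw [hR, finrank_top]
    simp
  set M : Matrix (Fin (m + 1)) (Fin (m + 1)) ℝ := Matrix.of fun i => f (Fin.cast hcard i) with hM
  have hdet : M.det ≠ 0 := by
    have hli : LinearIndependent ℝ M.row := hf.comp _ (Fin.cast_injective hcard)
    exact ((Matrix.isUnit_iff_isUnit_det M).1
      (Matrix.linearIndependent_rows_iff_isUnit.1 hli)).ne_zero
  refine ⟨⟨M.updateRow 0 (M.det⁻¹ • M 0), ?_⟩, fun i => ?_⟩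
  · rw [Matrix.det_updateRow_smul, Matrix.updateRow_eq_self, inv_mul_cancel₀ hdet]
  · refine ⟨if i = 0 then M.det⁻¹ else 1, M i, hfR _, ?_⟩
    by_cases hi : i = 0
    · subst hi
      rw [if_pos rfl]
      exact Matrix.updateRow_self
    · rw [if_neg hi, one_smul]
      exact Matrix.updateRow_ne hi

/-- A curve that is not contained in a proper affine subspace lifts to a spanning set of the
linear space of one dimension more. -/
lemma span_cons_one_eq_top (hm : 1 ≤ m) {I : Set ℝ} {φ : ℝ → Fin m → ℝ}
    (hflat : ¬ ∃ W : Submodule ℝ (Fin m → ℝ), W ≠ ⊤ ∧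
      ∀ s ∈ I, ∀ s' ∈ I, φ s - φ s' ∈ W) :
    Submodule.span ℝ ((fun s => (Fin.cons 1 (φ s) : Fin (m + 1) → ℝ)) '' I) = ⊤ := by
  have : Nonempty (Fin m) := ⟨⟨0, hm⟩⟩
  by_contra hne
  obtain ⟨f, hf0, hf⟩ := Submodule.exists_le_ker_of_lt_top _ (lt_top_iff_ne_top.2 hne)
  set η : (Fin m → ℝ) →ₗ[ℝ] ℝ := f.comp (LinearMap.pi
    (Fin.cons 0 fun i => LinearMap.proj i)) with hη
  have hsplit : ∀ (c : ℝ) (x : Fin m → ℝ),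
      f (Fin.cons c x) = c * f (Pi.single 0 1) + η x := by
    intro c x
    rw [hη, LinearMap.comp_apply, ← smul_eq_mul, ← map_smul, ← map_add]
    congr 1
    ext j
    refine Fin.cases ?_ (fun j => ?_) j <;> simp
  have hker : ∀ s ∈ I, f (Pi.single 0 1) + η (φ s) = 0 := by
    intro s hs
    have h : f (Fin.cons 1 (φ s)) = 0 := hf (Submodule.subset_span ⟨s, hs, rfl⟩)
    rwa [hsplit, one_mul] at h
  by_cases hη0 : η = 0
  · obtain ⟨s, hs⟩ : I.Nonempty := by
      by_contra hI
      rw [Set.not_nonempty_iff_eq_empty] at hI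
      exact hflat ⟨⊥, bot_ne_top, by simp [hI]⟩
    refine hf0 (LinearMap.ext fun x => ?_)
    have h := hker s hs
    rw [hη0, LinearMap.zero_apply, add_zero] at h
    rw [← Fin.cons_self_tail x, hsplit, h, hη0]
    simp
  · refine hflat ⟨LinearMap.ker η, fun h => hη0 (LinearMap.ker_eq_top.1 h), fun s hs s' hs' => ?_⟩
    rw [LinearMap.mem_ker, map_sub]
    linarith [hker s hs, hker s' hs']

end Curve

/-- Corollary 4.6 (cor:curve-main) of the paper. Let `φ : [a,b] → ℝ^{n-1}` be a
differentiable curve whose image is not contained in a proper affine subspace of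
`ℝ^{n-1}`, and let `v ≠ 0` satisfy `u(φ(s)) v ∈ V⁰ + V⁻` for all `s ∈ [a,b]`.
Then `v` is fixed by `G = SL(n, ℝ)`. -/
theorem fixed_by_G_of_curve {m : ℕ} (hm : 1 ≤ m)
    {V : Type*} [NormedAddCommGroup V] [NormedSpace ℝ V] [FiniteDimensional ℝ V]
    (ρ : Matrix.SpecialLinearGroup (Fin (m + 1)) ℝ →* Module.End ℝ V)
    (hcont : ∀ v : V, Continuous fun g => ρ g v)
    (hss : (⨆ μ : ℝ, wtSpace m ρ μ) = ⊤)
    (π₀ : V →ₗ[ℝ] V)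
    (hπ₀ : ∀ w ∈ wtSpace m ρ 0, π₀ w = w)
    (hπ : ∀ μ : ℝ, μ ≠ 0 → ∀ w ∈ wtSpace m ρ μ, π₀ w = 0)
    (a b : ℝ) (φ : ℝ → Fin m → ℝ)
    (hdiff : ∀ s ∈ Set.Icc a b, DifferentiableAt ℝ φ s)
    (hflat : ¬ ∃ W : Submodule ℝ (Fin m → ℝ), W ≠ ⊤ ∧
      ∀ s ∈ Set.Icc a b, ∀ s' ∈ Set.Icc a b, φ s - φ s' ∈ W)
    (v : V) (hv0 : v ≠ 0)
    (hneg : ∀ s ∈ Set.Icc a b,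
      ρ (uSL m (φ s)) v ∈ wtSpace m ρ 0 ⊔ ⨆ μ ∈ Set.Iio (0 : ℝ), wtSpace m ρ μ) :
    ∀ g : Matrix.SpecialLinearGroup (Fin (m + 1)) ℝ, ρ g v = v := by
  set R : Set (Fin (m + 1) → ℝ) := (fun s => Fin.cons 1 (φ s)) '' Set.Icc a b with hR
  have hRξ : ∀ x ∈ R, ∃ ξ : Fin m → ℝ, x = Fin.cons 1 ξ ∧
      ρ (uSL m ξ) v ∈ boundedVectors fun t => ρ (aSL m t) := by
    rintro _ ⟨s, hs, rfl⟩
    exact ⟨φ s, rfl, nonpos_weights_le_boundedVectors ρ (hneg s hs)⟩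
  obtain ⟨g, hg⟩ := exists_rows_of_span_eq_top (span_cons_one_eq_top hm hflat)
  set L : (Fin (m + 1) → ℝ) →ₗ[ℝ] (Fin (m + 1) → ℝ) :=
    Matrix.vecMulLinear (g⁻¹ : Matrix.SpecialLinearGroup (Fin (m + 1)) ℝ).1 with hL
  have hLg : ∀ x, L x ᵥ* g.1 = x := fun x => by
    rw [hL, Matrix.vecMulLinear_apply, Matrix.vecMul_vecMul, ← Matrix.SpecialLinearGroup.coe_mul,
      inv_mul_cancel, Matrix.SpecialLinearGroup.coe_one, Matrix.vecMul_one]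
  let Γ : Subgroup (Matrix.SpecialLinearGroup (Fin (m + 1)) ℝ) :=
    { carrier := {h | ρ h (ρ g v) = ρ g v}
      one_mem' := by simp
      mul_mem' := fun {h k} hh hk => by
        change ρ (h * k) (ρ g v) = ρ g v
        rw [map_mul, Module.End.mul_apply, show ρ k (ρ g v) = ρ g v from hk]
        exact hh
      inv_mem' := fun {h} hh => by
        change ρ h⁻¹ (ρ g v) = ρ g v
        conv_lhs => rw [← show ρ h (ρ g v) = ρ g v from hh]
        rw [← Module.End.mul_apply, ← map_mul, inv_mul_cancel, map_one, Module.End.one_apply] }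
  have hΓ : Γ = ⊤ := by
    refine eq_top_of_isPreconnected hm (A := L '' R) ?_ ?_ (fun i => ?_) fun h hh i t => ?_
    · refine (isPreconnected_Icc.image _ ?_).image _
        (LinearMap.continuous_of_finiteDimensional L).continuousOn
      refine continuousOn_pi.2 fun j => ?_
      refine Fin.cases ?_ (fun j => ?_) j
      · simpa using continuousOn_const
      · simp only [Fin.cons_succ]
        exact (continuous_apply j).comp_continuousOn
          (fun s hs => (hdiff s hs).continuousAt.continuousWithinAt : ContinuousOn φ _)
    · rintro ⟨x, hx, hx0⟩
      obtain ⟨ξ, rfl, -⟩ := hRξ x hx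
      have h0 := congrFun (hLg (Fin.cons 1 ξ)) 0
      rw [hx0, Matrix.zero_vecMul] at h0
      simp at h0
    · obtain ⟨c, x, hx, hcx⟩ := hg i
      refine ⟨c, L x, ⟨x, hx, rfl⟩, ?_⟩
      rw [← map_smul, ← hcx, hL, Matrix.vecMulLinear_apply]
      rw [← coe_mul_row, mul_inv_cancel]
      ext j
      simp [Matrix.one_apply, Pi.single_apply, eq_comm]
    · have hfix := torus_single_fixed_of_rows hcont hss (v := v) (h := h * g) (fun i => by
        obtain ⟨c, _, ⟨x, hx, rfl⟩, hcx⟩ := hh i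
        obtain ⟨ξ, hξ, hb⟩ := hRξ x hx
        refine ⟨c, ξ, ?_, hb⟩
        rw [coe_mul_row, hcx, Matrix.smul_vecMul, hLg, hξ]) i t
      change ρ (h⁻¹ * torus (Pi.single i t) * h) (ρ g v) = ρ g v
      rw [mul_assoc, map_mul, map_mul, Module.End.mul_apply, Module.End.mul_apply,
        ← Module.End.mul_apply (ρ h), ← map_mul, hfix, ← Module.End.mul_apply, ← map_mul,
        inv_mul_cancel_left]
  have hfix : ∀ h, ρ h (ρ g v) = ρ g v := fun h => (hΓ ▸ Subgroup.mem_top h : h ∈ Γ)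
  have hgv : ρ g v = v := by
    have h := hfix g⁻¹
    rwa [← Module.End.mul_apply, ← map_mul, inv_mul_cancel, map_one, Module.End.one_apply,
      eq_comm] at h
  intro h
  simpa only [hgv] using hfix h
end
end
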